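/- arXiv:math/0403215 — 8 statements merged into one kernel-verified Lean document; each statement's English description precedes it below -/
import Mathlib

section
/- Let A = ⊕_{i≥0} A_i be a positively graded finitely generated normal integral domain over ℂ of Krull dimension 2 with A_0 of Krull dimension 1 and A_1 ≠ 0 (a parabolic graded algebra). Let ∂ be a nonzero homogeneous locally nilpotent ℂ-derivation of A whose restriction to A_0 is zero (fiber type). Then ∂ has degree −1, and ker ∂ = A_0. -/
/-- A `ℂ`-derivation `D` of a commutative `ℂ`-algebra `A` is locally nilpotent if for every
`f ∈ A` there is `n` with `D^[n] f = 0`. -/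
def Derivation.IsLocallyNilpotent {A : Type*} [CommRing A] [Algebra ℂ A]
    (D : Derivation ℂ A A) : Prop :=
  ∀ f : A, ∃ n : ℕ, (⇑D)^[n] f = 0

/-- Lying over and going up for integral extensions bound the dimension of the base ring. -/
theorem ringKrullDim_le_of_isIntegral_of_faithfulSMul (R S : Type*) [CommRing R] [CommRing S]
    [Algebra R S] [Algebra.IsIntegral R S] [FaithfulSMul R S] :
    ringKrullDim R ≤ ringKrullDim S := by
  refine iSup_le fun l ↦ ?_
  obtain ⟨P, hP, hlo⟩ := (inferInstance : Nonempty (l.head.asIdeal.primesOver S))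
  obtain ⟨L, hL, -⟩ := Ideal.exists_ltSeries_of_hasGoingUp l P
  rw [← hL]
  exact le_iSup (fun L : LTSeries (PrimeSpectrum S) ↦ (L.length : WithBot ℕ∞)) L

theorem Algebra.trdeg_le_of_ringKrullDim_le (k A : Type*) [Field k] [CommRing A] [IsDomain A]
    [Algebra k A] [Algebra.FiniteType k A] {n : ℕ} (h : ringKrullDim A ≤ n) :
    Algebra.trdeg k A ≤ n := by
  obtain ⟨s, g, hg, hint⟩ := exists_integral_inj_algHom_of_fg k A
  algebraize [g.toRingHom]
  have : FaithfulSMul (MvPolynomial (Fin s) k) A :=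
    (faithfulSMul_iff_algebraMap_injective _ _).mpr hg
  have : IsScalarTower k (MvPolynomial (Fin s) k) A := .of_algHom g
  have hs : s ≤ n := by
    have := (ringKrullDim_le_of_isIntegral_of_faithfulSMul (MvPolynomial (Fin s) k) A).trans h
    simpa using this
  have := lift_trdeg_add_eq k (MvPolynomial (Fin s) k) A
  rw [trdeg_eq_zero (R := MvPolynomial (Fin s) k) (A := A)] at this
  simp only [MvPolynomial.trdeg_of_isDomain, Cardinal.mk_fin, Cardinal.lift_natCast,
    Cardinal.lift_zero, add_zero, Cardinal.nat_eq_lift_iff] at this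
  rw [← this]
  exact_mod_cast hs

theorem Algebra.Transcendental.of_ringKrullDim_pos (k A : Type*) [Field k] [CommRing A]
    [IsDomain A] [Algebra k A] (h : 0 < ringKrullDim A) : Algebra.Transcendental k A := by
  rw [Algebra.transcendental_iff_not_isAlgebraic]
  intro halg
  have := halg.isIntegral
  exact h.ne' (ringKrullDim_eq_zero_of_isField
    (isField_of_isIntegral_of_isField' (Field.toIsField k)))

namespace Derivation

/-- In characteristic zero, derivations vanish on algebraic extensions. -/
theorem eq_zero_of_isAlgebraic {R A : Type*} [CommRing R] [IsDomain R] [CharZero R] [CommRing A]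
    [IsDomain A] [Algebra R A] [FaithfulSMul R A] [Algebra.IsAlgebraic R A]
    (D : Derivation R A A) : D = 0 := by
  ext x
  obtain ⟨p, hp0, hp⟩ := Algebra.IsAlgebraic.isAlgebraic (R := R) x
  induction hn : p.natDegree using Nat.strong_induction_on generalizing p with
  | _ n ih =>
    have hpos : 0 < p.natDegree := by
      refine Nat.pos_of_ne_zero fun h ↦ hp0 ?_
      rw [Polynomial.eq_C_of_natDegree_eq_zero h] at hp ⊢
      rw [Polynomial.aeval_C, FaithfulSMul.algebraMap_eq_zero_iff] at hp
      simp [hp]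
    have hD := D.map_aeval p x
    rw [hp, map_zero, eq_comm, smul_eq_mul, mul_eq_zero] at hD
    refine hD.elim (fun h ↦ ?_) id
    refine ih _ (hn ▸ Polynomial.natDegree_derivative_lt hpos.ne') _ (fun h0 ↦ ?_) h rfl
    exact hpos.ne' (Polynomial.derivative_eq_zero.mp h0)

variable {R A : Type*} [CommRing R] [CommRing A] [Algebra R A]

/-- The same derivation, regarded as linear over an algebra on which it vanishes. -/
def overConstants (D : Derivation R A A) (S : Type*) [CommRing S] [Algebra S A]
    (h : ∀ s, D (algebraMap S A s) = 0) : Derivation S A A :=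
  Derivation.mk'
    { toFun := D
      map_add' := map_add D
      map_smul' := fun s a ↦ by simp [Algebra.smul_def, h] }
    fun a b ↦ D.leibniz a b

/-- The kernel of a derivation, as a subalgebra. -/
def kerSubalgebra (D : Derivation R A A) : Subalgebra R A where
  carrier := {a | D a = 0}
  mul_mem' {a b} ha hb := by
    rw [Set.mem_ofPred_eq] at ha hb ⊢
    simp [ha, hb]
  add_mem' {a b} ha hb := by
    rw [Set.mem_ofPred_eq] at ha hb ⊢
    simp [ha, hb]
  algebraMap_mem' r := D.map_algebraMap r

/-- A nonzero derivation makes its domain transcendental over its kernel. -/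
theorem transcendental_kerSubalgebra [IsDomain A] [CharZero A]
    {D : Derivation R A A} (hD : D ≠ 0) : Algebra.Transcendental D.kerSubalgebra A := by
  rw [Algebra.transcendental_iff_not_isAlgebraic]
  intro halg
  have : CharZero D.kerSubalgebra :=
    ⟨fun m n h ↦ Nat.cast_injective (R := A) (by simpa using congrArg Subtype.val h)⟩
  refine hD (Derivation.ext fun a ↦ ?_)
  have h := (D.overConstants D.kerSubalgebra fun s ↦ s.2).eq_zero_of_isAlgebraic
  exact DFunLike.congr_fun h a

/-- A nonzero derivation of a surface which vanishes on `S`, an algebra of positive dimension,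
has kernel algebraic over `S`. -/
theorem isAlgebraic_of_apply_eq_zero {k : Type*} [Field k] {A : Type*} [CommRing A] [IsDomain A]
    [CharZero A] [Algebra k A] [Algebra.FiniteType k A] (hdim : ringKrullDim A ≤ 2)
    (S : Subalgebra k A) (hS : 0 < ringKrullDim S) {D : Derivation k A A} (hD : D ≠ 0)
    (hDS : ∀ s ∈ S, D s = 0) {x : A} (hx : D x = 0) : IsAlgebraic S x := by
  by_contra htr
  let D' := D.overConstants S fun s ↦ hDS s s.2
  have hD'0 : D' ≠ 0 := fun h ↦ hD (Derivation.ext fun a ↦ DFunLike.congr_fun h a)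
  have := transcendental_kerSubalgebra hD'0
  have := Algebra.Transcendental.of_ringKrullDim_pos k S hS
  have : Algebra.Transcendental S D'.kerSubalgebra := by
    refine ⟨⟨⟨x, hx⟩, fun h ↦ htr ?_⟩⟩
    simpa using h.algHom D'.kerSubalgebra.val
  have : FaithfulSMul S D'.kerSubalgebra :=
    (faithfulSMul_iff_algebraMap_injective _ _).mpr fun a b h ↦
      Subtype.ext (congrArg (fun y : D'.kerSubalgebra ↦ (y : A)) h)
  have hle := Algebra.trdeg_le_of_ringKrullDim_le k A (n := 2) hdim
  rw [← trdeg_add_eq k S, ← trdeg_add_eq S D'.kerSubalgebra] at hle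
  have h1 := Cardinal.one_le_iff_pos.mpr (trdeg_pos k S)
  have h2 := Cardinal.one_le_iff_pos.mpr (trdeg_pos S D'.kerSubalgebra)
  have h3 := Cardinal.one_le_iff_pos.mpr (trdeg_pos D'.kerSubalgebra A)
  have h4 := (add_le_add h1 (add_le_add h2 h3)).trans hle
  norm_num at h4

theorem iterate_mem_graded {k A : Type*} [CommRing k] [CommRing A] [Algebra k A]
    (𝒜 : ℤ → Submodule k A) (D : Derivation k A A) {e : ℤ} (hD : ∀ n, ∀ a ∈ 𝒜 n, D a ∈ 𝒜 (n + e))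
    {d : ℤ} {f : A} (hf : f ∈ 𝒜 d) (n : ℕ) :
    D^[n] f ∈ 𝒜 (d + n * e) := by
  induction n with
  | zero => simpa using hf
  | succ n ih =>
    rw [Function.iterate_succ_apply']
    convert hD _ _ ih using 2
    push_cast
    ring

end Derivation

namespace GradedAlgebra

variable {k A : Type*} [CommRing k] [CommRing A] [Algebra k A] (𝒜 : ℤ → Submodule k A)
  [GradedAlgebra 𝒜]

theorem transcendental_of_mem [IsDomain A] {d : ℤ} (hd : d ≠ 0) {f : A} (hf : f ∈ 𝒜 d)
    (hf0 : f ≠ 0) : Transcendental (SetLike.GradeZero.subalgebra 𝒜) f := by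
  rw [transcendental_iff]
  intro p hp
  have hmem (i : ℕ) : (p.coeff i : A) * f ^ i ∈ 𝒜 (i • d) := by
    simpa using SetLike.mul_mem_graded (p.coeff i).2 (SetLike.pow_mem_graded i hf)
  ext n
  have hn : (p.coeff n : A) * f ^ n = 0 := by
    by_cases hnp : n ∈ p.support
    · rw [Polynomial.aeval_eq_sum_range' (Nat.lt_succ_self _)] at hp
      have := congrArg (fun a ↦ (DirectSum.decompose 𝒜 a (n • d) : A)) hp
      dsimp only at this
      rw [DirectSum.decompose_sum, DFinsupp.finsetSum_apply, AddSubmonoidClass.coe_finsetSum,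
        Finset.sum_eq_single n] at this
      · rw [Algebra.smul_def] at this
        erw [DirectSum.decompose_of_mem_same 𝒜 (hmem n)] at this
        simpa using this
      · intro i _ hi
        rw [Algebra.smul_def]
        refine DirectSum.decompose_of_mem_ne 𝒜 (hmem i) ?_
        simpa [hd] using hi
      · intro h
        exact absurd (Finset.mem_range_succ_iff.mpr (Polynomial.le_natDegree_of_mem_supp n hnp)) h
    · simp [Polynomial.notMem_support_iff.mp hnp]
  simpa [hf0] using hn

theorem decompose_derivation_apply (D : Derivation k A A) {e : ℤ}
    (hD : ∀ n, ∀ a ∈ 𝒜 n, D a ∈ 𝒜 (n + e)) (x : A) (i : ℤ) :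
    (DirectSum.decompose 𝒜 (D x) (i + e) : A) = D (DirectSum.decompose 𝒜 x i) := by
  induction x using DirectSum.Decomposition.inductionOn 𝒜 with
  | zero => simp
  | @homogeneous j m =>
    obtain rfl | hij := eq_or_ne j i
    · rw [DirectSum.decompose_of_mem_same 𝒜 m.2, DirectSum.decompose_of_mem_same 𝒜 (hD _ _ m.2)]
    · rw [DirectSum.decompose_of_mem_ne 𝒜 m.2 hij, map_zero,
        DirectSum.decompose_of_mem_ne 𝒜 (hD _ _ m.2) (by simpa using hij)]
  | add a b ha hb => simp [ha, hb]

end GradedAlgebra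


/-- Let `A = ⊕_{i ≥ 0} A_i` be a parabolic graded finitely generated normal
domain over `ℂ` of Krull dimension `2` (positively graded, `A_0` of Krull dimension `1`,
`A_1 ≠ 0`).  If `D` is a nonzero homogeneous locally nilpotent `ℂ`-derivation of `A` vanishing
on `A_0` (fiber type), then `D` has degree `-1` and `ker D = A_0`. -/
theorem fiber_type_lnd_has_degree_neg_one
    {A : Type*} [CommRing A] [IsDomain A] [Algebra ℂ A] [Algebra.FiniteType ℂ A]
    [IsIntegrallyClosed A]
    (𝒜 : ℤ → Submodule ℂ A) [GradedAlgebra 𝒜]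
    (hpos : ∀ i : ℤ, i < 0 → 𝒜 i = ⊥)
    (hdim : ringKrullDim A = 2)
    (hdim0 : ringKrullDim (SetLike.GradeZero.subalgebra 𝒜) = 1)
    (hA1 : 𝒜 1 ≠ ⊥)
    (D : Derivation ℂ A A) (hD : D.IsLocallyNilpotent) (hne : D ≠ 0)
    (e : ℤ) (hhom : ∀ (n : ℤ), ∀ a ∈ 𝒜 n, D a ∈ 𝒜 (n + e))
    (hfib : ∀ a ∈ 𝒜 0, D a = 0) :
    e = -1 ∧ ∀ x : A, D x = 0 ↔ x ∈ 𝒜 0 := by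
  have hdeg {d : ℤ} {f : A} (hf : f ∈ 𝒜 d) (hDf : D f = 0) (hf0 : f ≠ 0) : d = 0 := by
    by_contra hd
    have : CharZero A := charZero_of_injective_algebraMap (algebraMap ℂ A).injective
    exact GradedAlgebra.transcendental_of_mem 𝒜 hd hf hf0 <|
      Derivation.isAlgebraic_of_apply_eq_zero hdim.le (SetLike.GradeZero.subalgebra 𝒜)
        (hdim0 ▸ zero_lt_one) hne hfib hDf
  refine ⟨?_, fun x ↦ ⟨fun hx ↦ ?_, hfib x⟩⟩
  · obtain ⟨f, hf, hf0⟩ := Submodule.exists_mem_ne_zero_of_ne_bot hA1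
    classical
    obtain ⟨n, hn, hmin⟩ : ∃ n, D^[n + 1] f = 0 ∧ D^[n] f ≠ 0 := by
      have h0 : Nat.find (hD f) ≠ 0 := fun h ↦ hf0 (by simpa [h] using Nat.find_spec (hD f))
      obtain ⟨n, hn⟩ := Nat.exists_eq_succ_of_ne_zero h0
      exact ⟨n, by simpa only [hn] using Nat.find_spec (hD f), Nat.find_min (hD f) (by omega)⟩
    rw [Function.iterate_succ_apply'] at hn
    have h := hdeg (D.iterate_mem_graded 𝒜 hhom hf n) hn hmin
    have hu : (n : ℤ) * -e = 1 := by linarith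
    have := Int.eq_one_or_neg_one_of_mul_eq_one' hu
    omega
  · classical
    rw [← DirectSum.sum_support_decompose 𝒜 x]
    refine Submodule.sum_mem _ fun i hi ↦ ?_
    have hDi : D (DirectSum.decompose 𝒜 x i) = 0 := by
      simp [← GradedAlgebra.decompose_derivation_apply 𝒜 D hhom, hx]
    have hi0 : (DirectSum.decompose 𝒜 x i : A) ≠ 0 := by
      simpa [DFinsupp.mem_support_iff] using hi
    obtain rfl := hdeg (SetLike.coe_mem _) hDi hi0
    exact SetLike.coe_mem _
end

section
/- Let m₀, m₁ ≥ 2 be integers. Then there do not exist nonconstant polynomials λ, μ ∈ ℂ[t] satisfying λ^{m₀} = μ^{m₁} + 1. -/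
open Polynomial

/-- In characteristic different from two, the conic `a ^ 2 = b ^ 2 + 1` has only constant
polynomial points. -/
theorem Polynomial.natDegree_eq_zero_of_sq_eq_sq_add_one {k : Type*} [Field k]
    (h₂ : (2 : k) ≠ 0) {a b : k[X]} (h : a ^ 2 = b ^ 2 + 1) : a.natDegree = 0 := by
  have hab : (a + b) * (a - b) = 1 := by linear_combination h
  have hadd := natDegree_eq_zero_of_isUnit (.of_mul_eq_one _ hab)
  have hsub := natDegree_eq_zero_of_isUnit (.of_mul_eq_one_right _ hab)
  have hsum : C 2 * a = (a + b) + (a - b) := by rw [C_ofNat]; ring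
  rw [← natDegree_C_mul h₂, hsum]
  exact Nat.le_zero.mp ((natDegree_add_le _ _).trans (by simp [hadd, hsub]))

/-- For integers `m₀, m₁ ≥ 2` there are no nonconstant polynomials
`λ, μ ∈ ℂ[t]` with `λ ^ m₀ = μ ^ m₁ + 1`. -/
theorem no_nonconstant_polynomial_solutions_of_power_equation
    (m₀ m₁ : ℕ) (h₀ : 2 ≤ m₀) (h₁ : 2 ≤ m₁) :
    ¬ ∃ lam mu : Polynomial ℂ,
        1 ≤ lam.natDegree ∧ 1 ≤ mu.natDegree ∧ lam ^ m₀ = mu ^ m₁ + 1 := by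
  rintro ⟨lam, mu, hlam, hmu, h⟩
  suffices lam.natDegree = 0 by omega
  by_cases h22 : m₀ = 2 ∧ m₁ = 2
  · obtain ⟨rfl, rfl⟩ := h22
    exact natDegree_eq_zero_of_sq_eq_sq_add_one two_ne_zero h
  have hm₀ : m₀ ≠ 0 := by omega
  have hm₁ : m₁ ≠ 0 := by omega
  have hlt : m₀ + m₁ + 1 ≤ m₀ * m₁ := by
    obtain h | h : 3 ≤ m₀ ∨ 3 ≤ m₁ := by omega
    all_goals nlinarith
  have hcop : IsCoprime lam mu := by
    rw [← IsCoprime.pow_iff (Nat.pos_of_ne_zero hm₀) (Nat.pos_of_ne_zero hm₁)]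
    exact ⟨1, -1, by linear_combination h⟩
  refine (flt_catalan (r := m₀ * m₁) (c := 1) (u := 1) (v := -1) (w := -1) hm₀ hm₁
    (mul_ne_zero hm₀ hm₁) ?_ (by exact_mod_cast hm₀) (by exact_mod_cast hm₁)
    (by exact_mod_cast mul_ne_zero hm₀ hm₁) (ne_zero_of_natDegree_gt hlam)
    (ne_zero_of_natDegree_gt hmu) one_ne_zero hcop one_ne_zero (by simp) (by simp) ?_).1
  · nlinarith [Nat.mul_le_mul_left (m₀ * m₁) hlt]
  · simp only [map_neg, map_one, one_pow]
    linear_combination h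
end

section
/- Let P ∈ ℂ[t] be a polynomial and let k, e be integers with 1 ≤ k ≤ e. The ℂ-derivation δ of the polynomial ring ℂ[t,u,v] determined by δ(t) = u^e, δ(u) = 0 and δ(v) = P'(t)·u^{e−k} annihilates the polynomial u^k·v − P(t), hence descends to a ℂ-derivation ∂ of the quotient ring B = ℂ[t,u,v]/(u^k·v − P(t)), and this derivation ∂ is locally nilpotent. -/
open MvPolynomial

namespace Derivation

variable {R A : Type*} [CommRing R] [CommRing A] [Algebra R A]

theorem iterate_mul_eq_zero (D : Derivation R A A) {m n : ℕ} {a b : A}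
    (ha : D^[m] a = 0) (hb : D^[n] b = 0) : D^[m + n] (a * b) = 0 := by
  induction m generalizing a n b with
  | zero =>
    simp only [Function.iterate_zero, id_eq] at ha
    rw [ha, zero_mul, iterate_map_zero]
  | succ m ihm =>
    induction n generalizing b with
    | zero =>
      simp only [Function.iterate_zero, id_eq] at hb
      rw [hb, mul_zero, iterate_map_zero]
    | succ n ihn =>
      have h₁ := ihn (b := D b) (by rwa [← Function.iterate_succ_apply])
      have h₂ := ihm (a := D a) (by rwa [← Function.iterate_succ_apply]) hb
      rw [← add_assoc, Function.iterate_succ_apply, D.leibniz, iterate_map_add, smul_eq_mul,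
        smul_eq_mul, h₁, mul_comm b, add_right_comm m 1 n, add_assoc m n 1, h₂, add_zero]

theorem iterate_eq_zero_of_le (D : Derivation R A A) {m n : ℕ} (hmn : m ≤ n) {a : A}
    (ha : D^[m] a = 0) : D^[n] a = 0 := by
  obtain ⟨j, rfl⟩ := Nat.exists_eq_add_of_le' hmn
  rw [Function.iterate_add_apply, ha, iterate_map_zero]

/-- The subalgebra of elements annihilated by some iterate of a derivation. -/
def nilSubalgebra (D : Derivation R A A) : Subalgebra R A where
  carrier := {a | ∃ n : ℕ, D^[n] a = 0}
  mul_mem' := fun ⟨m, hm⟩ ⟨n, hn⟩ ↦ ⟨m + n, D.iterate_mul_eq_zero hm hn⟩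
  add_mem' := fun ⟨m, hm⟩ ⟨n, hn⟩ ↦ ⟨max m n, by
    rw [iterate_map_add, D.iterate_eq_zero_of_le (le_max_left m n) hm,
      D.iterate_eq_zero_of_le (le_max_right m n) hn, add_zero]⟩
  algebraMap_mem' r := ⟨1, D.map_algebraMap r⟩

theorem mem_nilSubalgebra {D : Derivation R A A} {a : A} :
    a ∈ D.nilSubalgebra ↔ ∃ n : ℕ, D^[n] a = 0 := Iff.rfl

theorem mem_nilSubalgebra_of_apply_mem {D : Derivation R A A} {a : A}
    (h : D a ∈ D.nilSubalgebra) : a ∈ D.nilSubalgebra := by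
  obtain ⟨n, hn⟩ := h
  exact ⟨n + 1, hn⟩

end Derivation

/-- Let `P ∈ ℂ[t]` and `1 ≤ k ≤ e`.  The `ℂ`-derivation `δ` of `ℂ[t,u,v]`
with `δ t = u^e`, `δ u = 0`, `δ v = P'(t)·u^{e-k}` kills `u^k·v - P(t)`, hence descends to a
`ℂ`-derivation `∂` of `B = ℂ[t,u,v]/(u^k·v - P(t))`, and `∂` is locally nilpotent.  Here
`t = X 0`, `u = X 1`, `v = X 2` in `MvPolynomial (Fin 3) ℂ`. -/
theorem derivation_descends_to_hypersurface_and_is_locally_nilpotent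
    (P : Polynomial ℂ) (k e : ℕ) (hk : 1 ≤ k) (hke : k ≤ e) :
    let δ : Derivation ℂ (MvPolynomial (Fin 3) ℂ) (MvPolynomial (Fin 3) ℂ) :=
      MvPolynomial.mkDerivation ℂ
        ![X 1 ^ e, 0, Polynomial.aeval (X 0 : MvPolynomial (Fin 3) ℂ) P.derivative
            * X 1 ^ (e - k)]
    let F : MvPolynomial (Fin 3) ℂ :=
      X 1 ^ k * X 2 - Polynomial.aeval (X 0 : MvPolynomial (Fin 3) ℂ) P
    δ F = 0 ∧
    ∃ D : Derivation ℂ (MvPolynomial (Fin 3) ℂ ⧸ Ideal.span {F})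
        (MvPolynomial (Fin 3) ℂ ⧸ Ideal.span {F}),
      (∀ f : MvPolynomial (Fin 3) ℂ,
        D (Ideal.Quotient.mk (Ideal.span {F}) f) = Ideal.Quotient.mk (Ideal.span {F}) (δ f)) ∧
      (∀ g, ∃ n : ℕ, (⇑D)^[n] g = 0) := by
  intro δ F
  have ht : δ (X 0) = X 1 ^ e := by simp [δ, mkDerivation_X]
  have hu : δ (X 1) = 0 := by simp [δ, mkDerivation_X]
  have hv : δ (X 2) = Polynomial.aeval (X 0 : MvPolynomial (Fin 3) ℂ) P.derivative
      * X 1 ^ (e - k) := by simp [δ, mkDerivation_X]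
  have hF : δ F = 0 := by
    simp only [F, map_sub, Derivation.leibniz, Derivation.leibniz_pow, hu, hv, Derivation.map_aeval,
      ht, smul_eq_mul, smul_zero, mul_zero, add_zero]
    rw [mul_left_comm, ← pow_add, Nat.add_sub_cancel' hke, sub_self]
  have hu_mem : X 1 ∈ δ.nilSubalgebra :=
    Derivation.mem_nilSubalgebra_of_apply_mem (hu ▸ zero_mem _)
  have ht_mem : X 0 ∈ δ.nilSubalgebra :=
    Derivation.mem_nilSubalgebra_of_apply_mem (ht ▸ pow_mem hu_mem e)
  have hv_mem : X 2 ∈ δ.nilSubalgebra :=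
    Derivation.mem_nilSubalgebra_of_apply_mem <| hv ▸ mul_mem
      (Algebra.adjoin_singleton_le ht_mem (Polynomial.aeval_mem_adjoin_singleton ℂ _))
      (pow_mem hu_mem _)
  have h_top : δ.nilSubalgebra = ⊤ := by
    rw [eq_top_iff, ← adjoin_range_X, Algebra.adjoin_le_iff]
    rintro _ ⟨i, rfl⟩
    fin_cases i
    exacts [ht_mem, hu_mem, hv_mem]
  have h_ker (x : MvPolynomial (Fin 3) ℂ)
      (hx : Ideal.Quotient.mkₐ ℂ (Ideal.span {F}) x = 0) :
      Ideal.Quotient.mkₐ ℂ (Ideal.span {F}) (δ x) = 0 := by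
    simp only [Ideal.Quotient.mkₐ_eq_mk, Ideal.Quotient.eq_zero_iff_mem] at hx ⊢
    obtain ⟨c, rfl⟩ := Ideal.mem_span_singleton.1 hx
    rw [δ.leibniz, hF, smul_zero, add_zero, smul_eq_mul]
    exact Ideal.mul_mem_right _ _ (Ideal.mem_span_singleton_self F)
  have h_surj := Ideal.Quotient.mkₐ_surjective ℂ (Ideal.span {F})
  have hD (f : MvPolynomial (Fin 3) ℂ) := Derivation.liftOfSurjective_apply h_surj h_ker f
  refine ⟨hF, Derivation.liftOfSurjective h_surj h_ker, hD, fun g ↦ ?_⟩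
  obtain ⟨f, rfl⟩ := h_surj g
  obtain ⟨n, hn⟩ := Derivation.mem_nilSubalgebra.1 (h_top ▸ Algebra.mem_top : f ∈ δ.nilSubalgebra)
  refine ⟨n, ?_⟩
  have h_semi : Function.Semiconj (Ideal.Quotient.mkₐ ℂ (Ideal.span {F})) δ
    (Derivation.liftOfSurjective h_surj h_ker) := fun f ↦ (hD f).symm
  rw [← (h_semi.iterate_right n).eq, hn, map_zero]
end

section
/- Let A be an integral domain that is a commutative ℂ-algebra, and let ∂ and ∂' be ℂ-derivations of A. Suppose there exist nonzero elements a, a' ∈ A with ∂(a) = ∂(a') = 0, ∂'(a) = ∂'(a') = 0, and a·∂ = a'·∂' (as derivations of A). Then ∂ and ∂' commute: ∂∘∂' = ∂'∘∂. -/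
/-- Let `A` be an integral domain which is a commutative `ℂ`-algebra, and let
`D`, `D'` be `ℂ`-derivations of `A`.  If there are nonzero `a, a' ∈ A` killed by both `D` and
`D'` with `a • D = a' • D'`, then `D` and `D'` commute. -/
theorem equivalent_derivations_commute
    {A : Type*} [CommRing A] [IsDomain A] [Algebra ℂ A]
    (D D' : Derivation ℂ A A) (a a' : A) (ha : a ≠ 0) (ha' : a' ≠ 0)
    (h1 : D a = 0) (h2 : D a' = 0) (h3 : D' a = 0) (h4 : D' a' = 0)
    (h5 : a • D = a' • D') :
    ∀ x : A, D (D' x) = D' (D x) := by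
  have key (y : A) : a * D y = a' * D' y := by
    simpa using DFunLike.congr_fun h5 y
  intro x
  have hD : a * D (D x) = a' * D (D' x) := by
    simpa [h1, h2] using congrArg D (key x)
  exact mul_left_cancel₀ ha' (hD.symm.trans (key (D x)))
end

section
/- Let n ≥ 1 and let A be a ℂ-subalgebra of the polynomial ring ℂ[X₁,…,Xₙ] such that A is stable under each partial derivative ∂/∂Xᵢ (i = 1,…,n), and such that for each i the intersection A ∩ ℂ[Xᵢ] contains a nonconstant polynomial (where ℂ[Xᵢ] denotes the subalgebra of polynomials in the single variable Xᵢ). Then A = ℂ[X₁,…,Xₙ]. -/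
open MvPolynomial

/-- A subalgebra stable under `∂/∂Xᵢ` that contains a nonconstant polynomial in `Xᵢ` alone
contains `Xᵢ`. -/
theorem X_mem_of_aeval_mem {σ K : Type*} [Field K] [CharZero K]
    (A : Subalgebra K (MvPolynomial σ K)) (i : σ) (hstab : ∀ f ∈ A, pderiv i f ∈ A)
    (m : ℕ) (p : Polynomial K) (hp : p.natDegree = m + 1)
    (hmem : Polynomial.aeval (X i : MvPolynomial σ K) p ∈ A) :
    (X i : MvPolynomial σ K) ∈ A := by
  induction m generalizing p with
  | zero =>
    obtain ⟨a, ha, b, rfl⟩ := Polynomial.natDegree_eq_one.mp hp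
    simp only [map_add, map_mul, Polynomial.aeval_C, Polynomial.aeval_X] at hmem
    have h : algebraMap K (MvPolynomial σ K) a * X i ∈ A := by
      simpa using A.sub_mem hmem (A.algebraMap_mem b)
    have h' := A.smul_mem h a⁻¹
    rwa [← Algebra.smul_def, inv_smul_smul₀ ha] at h'
  | succ m ih =>
    refine ih p.derivative ?_ ?_
    · rw [Polynomial.natDegree_derivative, hp]
      rfl
    · simpa [Derivation.map_aeval] using hstab _ hmem

/-- Let `n ≥ 1` and let `A` be a `ℂ`-subalgebra of `ℂ[X₁,…,Xₙ]` stable under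
each partial derivative `∂/∂Xᵢ` and such that, for each `i`, `A ∩ ℂ[Xᵢ]` contains a nonconstant
polynomial.  Then `A = ℂ[X₁,…,Xₙ]`. -/
theorem subalgebra_stable_under_partials_eq_top
    (n : ℕ) (hn : 1 ≤ n)
    (A : Subalgebra ℂ (MvPolynomial (Fin n) ℂ))
    (hstab : ∀ (i : Fin n), ∀ f ∈ A, pderiv i f ∈ A)
    (hsingle : ∀ i : Fin n, ∃ p : Polynomial ℂ,
      1 ≤ p.natDegree ∧ Polynomial.aeval (X i : MvPolynomial (Fin n) ℂ) p ∈ A) :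
    A = ⊤ := by
  rw [eq_top_iff, ← adjoin_range_X, Algebra.adjoin_le_iff]
  rintro _ ⟨i, rfl⟩
  obtain ⟨p, hp, hmem⟩ := hsingle i
  exact X_mem_of_aeval_mem A i (hstab i) (p.natDegree - 1) p (by omega) hmem
end

section
/- Let A = ⊕_{i∈ℤ} A_i be a ℤ-graded finitely generated normal integral domain over ℂ of Krull dimension 2 with A_0 of Krull dimension 1 and A_1 ≠ 0, and assume A is parabolic (A_i = 0 for i < 0) or hyperbolic (A_{-1} ≠ 0). Let ∂ be a nonzero homogeneous locally nilpotent ℂ-derivation of A of degree e ≥ 0, and suppose there is a nonzero element u ∈ A_1 with ∂(u) = 0. Then there exists t ∈ A_0 such that the ℂ-algebra homomorphism ℂ[T,U] → A sending T ↦ t, U ↦ u is injective with image the subalgebra A_{≥0} = ⊕_{n≥0} A_n (so A_{≥0} is a polynomial ring in t and u, with A_0 = ℂ[t]), and the restriction of ∂ to A_{≥0} equals x·∂/∂t, where x := ∂(t) is a homogeneous element of A_e. -/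
open MvPolynomial

/-- The extension of a derivation of a domain to a field of fractions. -/
theorem Derivation.exists_extension_fractionField {k A K : Type*} [CommRing k] [CommRing A]
    [IsDomain A] [Algebra k A] [Field K] [Algebra A K] [IsFractionRing A K] [Algebra k K]
    [IsScalarTower k A K] (D : Derivation k A A) :
    ∃ E : Derivation k K K, ∀ a, E (algebraMap A K a) = algebraMap A K (D a) := by
  have := Algebra.FormallyEtale.of_isLocalization (Rₘ := K) (nonZeroDivisors A)
  let φ : TensorProduct A K (Ω[A⁄k]) →ₗ[K] K :=
    LinearMap.liftBaseChange K ((Algebra.linearMap A K).comp D.liftKaehlerDifferential)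
  refine ⟨(φ ∘ₗ (KaehlerDifferential.tensorKaehlerEquivOfFormallyEtale k A
    K).symm.toLinearMap).compDer (KaehlerDifferential.D k K), fun a ↦ ?_⟩
  simp [KaehlerDifferential.tensorKaehlerEquivOfFormallyEtale_symm_D_algebraMap, φ]

/-- Over a ring of constants of a derivation, an element which is not a constant is
transcendental. -/
theorem Derivation.transcendental_of_apply_ne_zero {k K : Type*} [CommRing k] [Field K]
    [CharZero K] [Algebra k K] (E : Derivation k K K) (S : Subalgebra k K)
    (hS : ∀ x ∈ S, E x = 0) {a : K} (ha : E a ≠ 0) : Transcendental S a := by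
  let E' : Derivation S K K := Derivation.mk'
    { toFun := E
      map_add' := map_add E
      map_smul' := fun r x ↦ by
        simp [Algebra.smul_def, hS r r.2] }
    fun x y ↦ E.leibniz x y
  have hE' : E' a ≠ 0 := ha
  suffices ∀ n : ℕ, ∀ p : Polynomial S, p.natDegree = n → Polynomial.aeval a p = 0 → p = 0 from
    fun ⟨p, hp, h⟩ ↦ hp (this _ p rfl h)
  intro n
  induction n with
  | zero =>
    intro p hp h
    rw [Polynomial.eq_C_of_natDegree_eq_zero hp] at h ⊢
    simpa [Subalgebra.algebraMap_def] using h
  | succ n ih =>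
    intro p hp h
    have h1 := E'.map_aeval p a
    rw [h, map_zero, eq_comm, smul_eq_zero, or_iff_left hE'] at h1
    have h2 := ih _ (by rw [Polynomial.natDegree_derivative, hp]; rfl) h1
    have := Polynomial.derivative_eq_zero.1 h2
    omega

theorem ringKrullDim_le_of_isIntegral {R S : Type*} [CommRing R] [CommRing S] [Algebra R S]
    [Algebra.IsIntegral R S] [FaithfulSMul R S] : ringKrullDim R ≤ ringKrullDim S := by
  refine iSup_le fun l ↦ ?_
  obtain ⟨P, hP, hl⟩ : ∃ P : Ideal S, P.IsPrime ∧ P.LiesOver l.head.asIdeal := by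
    obtain ⟨P, -, hP, h⟩ := Ideal.exists_ideal_over_prime_of_isIntegral l.head.asIdeal (⊥ : Ideal S)
      (by
        rw [Ideal.comap_bot_of_injective _ (FaithfulSMul.algebraMap_injective R S)]
        exact bot_le)
    exact ⟨P, hP, ⟨h.symm⟩⟩
  obtain ⟨L, hL, -⟩ := Ideal.exists_ltSeries_of_hasGoingUp (S := S) l P
  exact hL ▸ Order.LTSeries.length_le_krullDim L

/-- The transcendence degree of a fraction field is at most the Krull dimension. -/
theorem trdeg_fractionField_le {k A K : Type*} [Field k] [CommRing A]
    [IsDomain A] [Algebra k A] [Algebra.FiniteType k A] [Field K] [Algebra A K]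
    [IsFractionRing A K] [Algebra k K] [IsScalarTower k A K] (d : ℕ) (h : ringKrullDim A ≤ d) :
    Algebra.trdeg k K ≤ d := by
  obtain ⟨s, g, hg, hint⟩ := exists_integral_inj_algHom_of_fg k A
  algebraize [g.toRingHom]
  let : Algebra (MvPolynomial (Fin s) k) K :=
    ((algebraMap A K).comp (algebraMap _ A)).toAlgebra
  have : IsScalarTower (MvPolynomial (Fin s) k) A K := .of_algebraMap_eq fun _ ↦ rfl
  have : IsScalarTower k (MvPolynomial (Fin s) k) K := .of_algebraMap_eq fun x ↦ by
    rw [IsScalarTower.algebraMap_apply k A K, IsScalarTower.algebraMap_apply _ A K]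
    exact congr_arg _ (g.commutes x).symm
  have : FaithfulSMul (MvPolynomial (Fin s) k) A := (faithfulSMul_iff_algebraMap_injective _ _).2 hg
  have : FaithfulSMul (MvPolynomial (Fin s) k) K := (faithfulSMul_iff_algebraMap_injective _ _).2
    ((IsFractionRing.injective A K).comp hg)
  have : Algebra.IsAlgebraic A K := IsFractionRing.comap_isAlgebraic_iff (K := K) |>.2 inferInstance
  have : Algebra.IsAlgebraic (MvPolynomial (Fin s) k) K := Algebra.IsAlgebraic.trans _ A _
  have hs : s ≤ d := by
    have h1 := (ringKrullDim_le_of_isIntegral (R := MvPolynomial (Fin s) k) (S := A)).trans h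
    rw [MvPolynomial.ringKrullDim_of_isNoetherianRing, ringKrullDim_eq_zero_of_field] at h1
    rw [zero_add, Nat.card_fin] at h1
    exact_mod_cast h1
  have h2 := lift_trdeg_add_eq k (MvPolynomial (Fin s) k) K
  rw [MvPolynomial.trdeg_of_isDomain, trdeg_eq_zero] at h2
  simp only [Cardinal.mk_fin, Cardinal.lift_natCast, Cardinal.lift_zero, add_zero] at h2
  rw [eq_comm, Cardinal.lift_eq_nat_iff] at h2
  rw [h2]
  exact_mod_cast hs

theorem Derivation.pow_mul_apply_eq {k A K : Type*} [CommRing k] [CommRing A] [Algebra k A]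
    [CommRing K] [Algebra A K] [Algebra k K] {D : Derivation k A A} {E : Derivation k K K}
    (hED : ∀ a, E (algebraMap A K a) = algebraMap A K (D a)) {u : A} (hDu : D u = 0)
    {n : ℕ} {w : K} {g : A} (h : algebraMap A K u ^ n * w = algebraMap A K g) :
    algebraMap A K u ^ n * E w = algebraMap A K (D g) := by
  rw [← hED, ← h, E.leibniz, E.leibniz_pow, hED, hDu]
  simp

section Graded

variable {k A : Type*} [Field k] [CommRing A] [Algebra k A]
  (𝒜 : ℤ → Submodule k A) [GradedAlgebra 𝒜]

theorem GradedAlgebra.mem_of_mul_mem [IsDomain A] {x y : A} {m i : ℤ} (hx : x ∈ 𝒜 m) (hx0 : x ≠ 0)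
    (h : x * y ∈ 𝒜 (m + i)) : y ∈ 𝒜 i := by
  have h1 := DirectSum.coe_decompose_mul_add_of_left_mem 𝒜 (j := i) (b := y) hx
  rw [DirectSum.decompose_of_mem_same 𝒜 h] at h1
  rw [mul_left_cancel₀ hx0 h1]
  exact SetLike.coe_mem _

theorem GradedAlgebra.eq_zero_of_sum_eq_zero {ι : Type*} (s : Finset ι) {c : ι → ℤ}
    (hc : Function.Injective c) {f : ι → A} (hf : ∀ i ∈ s, f i ∈ 𝒜 (c i))
    (h : ∑ i ∈ s, f i = 0) {j : ι} (hj : j ∈ s) : f j = 0 := by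
  have h1 := congr_arg (GradedRing.proj 𝒜 (c j)) h
  rw [map_sum, map_zero, Finset.sum_eq_single_of_mem j hj] at h1
  · rwa [GradedRing.proj_apply, DirectSum.decompose_of_mem_same 𝒜 (hf j hj)] at h1
  · intro i hi hij
    rw [GradedRing.proj_apply, DirectSum.decompose_of_mem_ne 𝒜 (hf i hi) (hc.ne hij)]

theorem GradedAlgebra.pow_mul_mem {u : A} (hu : u ∈ 𝒜 1) {g : A} {n : ℕ} (hg : g ∈ 𝒜 n) (m : ℕ) :
    u ^ m * g ∈ 𝒜 (m + n : ℕ) := by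
  simpa using SetLike.mul_mem_graded (SetLike.pow_mem_graded m hu) hg

variable {𝒜} (K : Type*) [Field K] [Algebra A K] [Algebra k K]
  [IsScalarTower k A K]

/-- The degree zero part of the localization of `A` at `u ∈ 𝒜 1`, as a subalgebra of a
field of fractions `K` of `A`. -/
def GradedAlgebra.awayDegreeZero {u : A} (hu : u ∈ 𝒜 1) : Subalgebra k K where
  carrier := {w | ∃ n : ℕ, ∃ g ∈ 𝒜 n, algebraMap A K u ^ n * w = algebraMap A K g}
  mul_mem' := by
    rintro a b ⟨n, g, hg, h⟩ ⟨m, g', hg', h'⟩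
    refine ⟨n + m, g * g', by simpa using SetLike.mul_mem_graded hg hg', ?_⟩
    rw [map_mul, ← h, ← h']
    ring
  add_mem' := by
    rintro a b ⟨n, g, hg, h⟩ ⟨m, g', hg', h'⟩
    refine ⟨n + m, u ^ m * g + u ^ n * g', add_mem ?_ (pow_mul_mem 𝒜 hu hg' n), ?_⟩
    · rw [add_comm n m]
      exact pow_mul_mem 𝒜 hu hg m
    · rw [map_add, map_mul, map_mul, ← h, ← h', map_pow, map_pow]
      ring
  algebraMap_mem' c := ⟨0, algebraMap k A c, by simpa using SetLike.algebraMap_mem_graded 𝒜 c, by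
    rw [← IsScalarTower.algebraMap_apply, pow_zero, one_mul]⟩

theorem GradedAlgebra.exists_common_denominator {u : A} (hu : u ∈ 𝒜 1) {ι : Type*}
    (s : Finset ι) (w : ι → K) (hw : ∀ i, w i ∈ awayDegreeZero K hu) :
    ∃ N : ℕ, ∃ g : ι → A, ∀ i ∈ s, g i ∈ 𝒜 N ∧
      algebraMap A K u ^ N * w i = algebraMap A K (g i) := by
  choose n g hg h using hw
  refine ⟨∑ i ∈ s, n i, fun i ↦ u ^ (∑ i ∈ s, n i - n i) * g i, fun i hi ↦ ?_⟩
  have hle : n i ≤ ∑ i ∈ s, n i := Finset.single_le_sum (fun _ _ ↦ Nat.zero_le _) hi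
  constructor
  · convert pow_mul_mem 𝒜 hu (hg i) (∑ i ∈ s, n i - n i) using 3
    omega
  · rw [map_mul, ← h, map_pow, ← mul_assoc, ← pow_add, Nat.sub_add_cancel hle]

theorem GradedAlgebra.transcendental_awayDegreeZero [IsDomain A] [IsFractionRing A K]
    {u : A} (hu : u ∈ 𝒜 1) (hu0 : u ≠ 0) :
    Transcendental (awayDegreeZero K hu) (algebraMap A K u) := by
  rintro ⟨p, hp, h⟩
  have hu' : algebraMap A K u ≠ 0 := by simpa using hu0
  obtain ⟨N, g, hg⟩ := exists_common_denominator K hu p.support (fun i ↦ (p.coeff i : K))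
    (fun i ↦ (p.coeff i).2)
  have hsum : ∑ i ∈ p.support, u ^ i * g i = 0 := by
    apply IsFractionRing.injective A K
    rw [map_sum, map_zero, ← mul_zero (algebraMap A K u ^ N), ← h, Polynomial.aeval_def,
      Polynomial.eval₂_eq_sum, Polynomial.sum_def, Finset.mul_sum]
    refine Finset.sum_congr rfl fun i hi ↦ ?_
    rw [map_mul, ← (hg i hi).2, map_pow, Subalgebra.algebraMap_def, Algebra.algebraMap_self_apply]
    ring
  obtain ⟨j, hj⟩ := Polynomial.nonempty_support_iff.2 hp
  have h1 := eq_zero_of_sum_eq_zero 𝒜 p.support (c := fun i ↦ ((i + N : ℕ) : ℤ))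
    (fun _ _ h ↦ by simpa using h) (fun i hi ↦ pow_mul_mem 𝒜 hu (hg i hi).1 i) hsum hj
  have h2 := (hg j hj).2
  rw [(mul_eq_zero_iff_left (pow_ne_zero j hu0)).1 h1, map_zero,
    mul_eq_zero_iff_left (pow_ne_zero N hu')] at h2
  exact Polynomial.mem_support_iff.1 hj (Subtype.ext h2)

theorem GradedAlgebra.algebraicIndependent_option [IsDomain A] [IsFractionRing A K]
    {u : A} (hu : u ∈ 𝒜 1) (hu0 : u ≠ 0) {w : K}
    (hw : w ∈ awayDegreeZero K hu) (hwt : Transcendental k w) :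
    AlgebraicIndependent k
      (fun o : Option Unit ↦ o.elim (algebraMap A K u) (fun _ ↦ w)) := by
  refine AlgebraicIndependent.option_iff.2 ⟨algebraicIndependent_unique_type_iff.2 hwt, ?_⟩
  refine Transcendental.of_tower_top_of_subalgebra_le (B := awayDegreeZero K hu) ?_
    (transcendental_awayDegreeZero K hu hu0)
  rw [Algebra.adjoin_le_iff]
  rintro _ ⟨_, rfl⟩
  exact hw

theorem GradedAlgebra.exists_algebraMap_eq_of_derivation_eq_zero [IsDomain A] [IsFractionRing A K]
    [IsAlgClosed k] [CharZero K]
    (htr : Algebra.trdeg k K ≤ 2) (E : Derivation k K K) {u : A} (hu : u ∈ 𝒜 1) (hu0 : u ≠ 0)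
    (hEu : E (algebraMap A K u) = 0) (hE : E ≠ 0) {w : K} (hw : w ∈ awayDegreeZero K hu)
    (hEw : E w = 0) : ∃ c : k, algebraMap k K c = w := by
  by_cases hwt : Transcendental k w
  · exfalso
    obtain ⟨a, ha⟩ : ∃ a, E a ≠ 0 := by
      by_contra! h
      exact hE (Derivation.ext h)
    have h3 := AlgebraicIndependent.option_iff.2 ⟨algebraicIndependent_option K hu hu0 hw hwt,
      E.transcendental_of_apply_ne_zero _ (fun x hx ↦ ?_) ha⟩
    · have := h3.lift_cardinalMk_le_trdeg
      simp only [Cardinal.mk_option, Cardinal.mk_unit] at this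
      have h4 := (Cardinal.lift_le.2 htr).trans' this
      norm_num at h4
    · refine (E.eqOn_adjoin (D2 := 0) ?_) hx
      rintro _ ⟨(_ | _), rfl⟩
      exacts [hEu, hEw]
  · have h1 : IsIntegral k w := (not_not.1 hwt : IsAlgebraic k w).isIntegral
    exact minpoly.mem_range_of_degree_eq_one k w
      (IsAlgClosed.degree_eq_one_of_irreducible k (minpoly.irreducible h1))

theorem Polynomial.exists_derivative_eq {k : Type*} [Field k] [CharZero k] (q : Polynomial k) :
    ∃ p : Polynomial k, p.derivative = q := by
  induction q using Polynomial.induction_on' with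
  | add p q hp hq =>
    obtain ⟨p', rfl⟩ := hp
    obtain ⟨q', rfl⟩ := hq
    exact ⟨p' + q', map_add _ _ _⟩
  | monomial n a =>
    refine ⟨Polynomial.monomial (n + 1) (a / (n + 1)), ?_⟩
    rw [Polynomial.derivative_monomial, Nat.add_sub_cancel]
    congr 1
    have : (n : k) + 1 ≠ 0 := Nat.cast_add_one_ne_zero n
    push_cast
    field_simp

/-- A homogeneous element on which a homogeneous locally nilpotent derivation acts with
nilpotency order exactly two. -/
theorem Derivation.exists_homogeneous_local_slice {D : Derivation k A A} (hD0 : D ≠ 0)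
    (hD : ∀ f : A, ∃ n : ℕ, (⇑D)^[n] f = 0) {e : ℕ}
    (hhom : ∀ (n : ℤ), ∀ a ∈ 𝒜 n, D a ∈ 𝒜 (n + e)) :
    ∃ i : ℤ, ∃ a ∈ 𝒜 i, D a ≠ 0 ∧ D (D a) = 0 := by
  obtain ⟨i, f, hf, hDf⟩ : ∃ i : ℤ, ∃ f ∈ 𝒜 i, D f ≠ 0 := by
    by_contra! h
    classical
    refine hD0 (Derivation.ext fun a ↦ ?_)
    rw [← DirectSum.sum_support_decompose 𝒜 a, map_sum]
    exact Finset.sum_eq_zero fun i _ ↦ h i _ (SetLike.coe_mem _)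
  have hiter (n : ℕ) : ∃ j : ℤ, (⇑D)^[n] f ∈ 𝒜 j := by
    induction n with
    | zero => exact ⟨i, hf⟩
    | succ n ih =>
      obtain ⟨j, hj⟩ := ih
      exact ⟨j + e, by rw [Function.iterate_succ_apply']; exact hhom j _ hj⟩
  classical
  have hn := Nat.find_spec (hD f)
  have hmin := fun m ↦ Nat.find_min (hD f) (m := m)
  generalize Nat.find (hD f) = n at hn hmin
  match n, hn, hmin with
  | 0, hn, _ => exact absurd (by simp [show f = 0 from hn]) hDf
  | 1, hn, _ => exact absurd hn hDf
  | n + 2, hn, hmin =>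
    obtain ⟨j, hj⟩ := hiter n
    refine ⟨j, _, hj, ?_, ?_⟩
    · rw [← Function.iterate_succ_apply' D]
      exact hmin _ (by omega)
    · rw [← Function.iterate_succ_apply' D, ← Function.iterate_succ_apply' D]
      exact hn

variable {K}

theorem GradedAlgebra.exists_slice_awayDegreeZero [IsDomain A] [IsFractionRing A K]
    {D : Derivation k A A} {E : Derivation k K K} (hD0 : D ≠ 0)
    (hD : ∀ f : A, ∃ n : ℕ, (⇑D)^[n] f = 0) {e : ℕ}
    (hhom : ∀ (n : ℤ), ∀ a ∈ 𝒜 n, D a ∈ 𝒜 (n + e))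
    (hED : ∀ a, E (algebraMap A K a) = algebraMap A K (D a))
    {u : A} (hu : u ∈ 𝒜 1) (hu0 : u ≠ 0) (hDu : D u = 0)
    (hker : ∀ w ∈ awayDegreeZero K hu, E w = 0 → ∃ c : k, algebraMap k K c = w) :
    ∃ t ∈ awayDegreeZero K hu, E t = algebraMap A K u ^ e := by
  have hu' : algebraMap A K u ≠ 0 := by simpa using hu0
  obtain ⟨i, a, ha, hDa, hDDa⟩ := Derivation.exists_homogeneous_local_slice hD0 hD hhom
  obtain ⟨m, hm⟩ : ∃ m : ℕ, (i.natAbs : ℤ) + i = m := ⟨(i.natAbs + i).toNat, by omega⟩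
  have hb : u ^ i.natAbs * a ∈ 𝒜 m := by
    rw [← hm]
    simpa using SetLike.mul_mem_graded (SetLike.pow_mem_graded i.natAbs hu) ha
  have hD1 (x : A) (n : ℕ) : D (u ^ n * x) = u ^ n * D x := by
    simp [D.leibniz, D.leibniz_pow, hDu]
  have hDb : D (u ^ i.natAbs * a) ≠ 0 := by
    rw [hD1]
    exact mul_ne_zero (pow_ne_zero _ hu0) hDa
  have hDDb : D (D (u ^ i.natAbs * a)) = 0 := by rw [hD1, hD1, hDDa, mul_zero]
  generalize u ^ i.natAbs * a = b at hb hDb hDDb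
  have hv : algebraMap A K u ^ (m + e) * (algebraMap A K (D b) / algebraMap A K u ^ (m + e)) =
    algebraMap A K (D b) := mul_div_cancel₀ _ (pow_ne_zero _ hu')
  obtain ⟨c, hc⟩ := hker _ ⟨m + e, D b, by simpa using hhom m b hb, hv⟩ (by
    have := Derivation.pow_mul_apply_eq hED hDu hv
    rw [hDDb, map_zero] at this
    exact (mul_eq_zero_iff_left (pow_ne_zero _ hu')).1 this)
  have hc0 : algebraMap k K c ≠ 0 := by
    rw [hc]
    exact div_ne_zero (by simpa using hDb) (pow_ne_zero _ hu')
  have hw : algebraMap A K u ^ m * (algebraMap A K b / algebraMap A K u ^ m) = algebraMap A K b :=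
    mul_div_cancel₀ _ (pow_ne_zero _ hu')
  refine ⟨c⁻¹ • (algebraMap A K b / algebraMap A K u ^ m),
    (awayDegreeZero K hu).smul_mem (show _ ∈ awayDegreeZero K hu from ⟨m, b, hb, hw⟩) _, ?_⟩
  have h1 := Derivation.pow_mul_apply_eq hED hDu hw
  rw [← hv, ← hc, pow_add, mul_assoc] at h1
  rw [E.map_smul, mul_left_cancel₀ (pow_ne_zero m hu') h1, Algebra.smul_def, map_inv₀]
  field_simp

theorem GradedAlgebra.exists_eq_pow_mul_aeval [IsDomain A] [IsFractionRing A K] [CharZero k]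
    {D : Derivation k A A} {E : Derivation k K K} {e : ℕ}
    (hhom : ∀ (n : ℤ), ∀ a ∈ 𝒜 n, D a ∈ 𝒜 (n + e))
    (hED : ∀ a, E (algebraMap A K a) = algebraMap A K (D a))
    {u : A} (hu : u ∈ 𝒜 1) (hu0 : u ≠ 0) (hDu : D u = 0)
    (hker : ∀ w ∈ awayDegreeZero K hu, E w = 0 → ∃ c : k, algebraMap k K c = w)
    {t : K} (ht : t ∈ awayDegreeZero K hu) (hEt : E t = algebraMap A K u ^ e)
    (l : ℕ) {n : ℕ} {f : A} (hf : f ∈ 𝒜 n) (hl : (⇑D)^[l] f = 0) :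
    ∃ p : Polynomial k, algebraMap A K f = algebraMap A K u ^ n * Polynomial.aeval t p := by
  have hu' : algebraMap A K u ≠ 0 := by simpa using hu0
  induction l generalizing n f with
  | zero => exact ⟨0, by simp [show f = 0 from hl]⟩
  | succ l ih =>
    obtain ⟨q, hq⟩ := ih (n := n + e) (f := D f) (by simpa using hhom n f hf)
      (by rwa [← Function.iterate_succ_apply])
    obtain ⟨p, rfl⟩ := Polynomial.exists_derivative_eq q
    have hw : algebraMap A K u ^ n * (algebraMap A K f / algebraMap A K u ^ n) =
      algebraMap A K f := mul_div_cancel₀ _ (pow_ne_zero _ hu')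
    have h1 := Derivation.pow_mul_apply_eq hED hDu hw
    rw [hq, pow_add, mul_assoc] at h1
    have h2 := mul_left_cancel₀ (pow_ne_zero n hu') h1
    obtain ⟨c, hc⟩ := hker (algebraMap A K f / algebraMap A K u ^ n - Polynomial.aeval t p)
      (sub_mem (show _ ∈ awayDegreeZero K hu from ⟨n, f, hf, hw⟩)
        (Algebra.adjoin_singleton_le ht (Polynomial.aeval_mem_adjoin_singleton k t)))
      (by rw [map_sub, h2, E.map_aeval, hEt, smul_eq_mul, mul_comm, sub_self])
    refine ⟨p + Polynomial.C c, ?_⟩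
    rw [map_add, Polynomial.aeval_C, hc, add_sub_cancel, hw]

end Graded

theorem MvPolynomial.derivation_aeval_pair {k A : Type*} [CommRing k] [CommRing A] [Algebra k A]
    (D : Derivation k A A) (t : A) {u : A} (hDu : D u = 0) (p : MvPolynomial (Fin 2) k) :
    D (aeval ![t, u] p) = D t * aeval ![t, u] (pderiv 0 p) := by
  induction p using MvPolynomial.induction_on with
  | C a => simp
  | add p q hp hq => simp only [map_add, hp, hq, mul_add]
  | mul_X p i hp =>
    rw [map_mul, D.leibniz, hp, Derivation.leibniz, aeval_X]
    fin_cases i <;> simp [hDu, pderiv_X] <;> ring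

theorem GradedAlgebra.aeval_pair_mem_iSup {k A : Type*} [CommRing k] [CommRing A] [Algebra k A]
    (𝒜 : ℤ → Submodule k A) [GradedAlgebra 𝒜] {t u : A} (ht : t ∈ 𝒜 0) (hu : u ∈ 𝒜 1)
    (p : MvPolynomial (Fin 2) k) : aeval ![t, u] p ∈ ⨆ n : ℕ, 𝒜 (n : ℤ) := by
  induction p using MvPolynomial.induction_on' with
  | add p q hp hq =>
    rw [map_add]
    exact add_mem hp hq
  | monomial s c =>
    refine Submodule.mem_iSup_of_mem (s 1) ?_
    rw [aeval_monomial, Finsupp.prod_fintype _ _ (by simp), Fin.prod_univ_two, ← Algebra.smul_def]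
    exact Submodule.smul_mem _ _ (by
      simpa using SetLike.mul_mem_graded (SetLike.pow_mem_graded (s 0) ht)
        (SetLike.pow_mem_graded (s 1) hu))

/-- A graded domain over a field whose degree zero part has positive Krull dimension contains a
transcendental element of degree zero. -/
theorem GradedAlgebra.exists_transcendental_mem_zero {k A : Type*} [Field k] [CommRing A]
    [IsDomain A] [Algebra k A] (𝒜 : ℤ → Submodule k A) [GradedAlgebra 𝒜]
    (h : ringKrullDim (SetLike.GradeZero.subalgebra 𝒜) ≠ 0) : ∃ p ∈ 𝒜 0, Transcendental k p := by
  by_contra! hp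
  have : Algebra.IsIntegral k (SetLike.GradeZero.subalgebra 𝒜) := ⟨fun x ↦ by
    have h1 : IsAlgebraic k (x : A) := not_not.1 (hp x x.2)
    exact (isIntegral_algHom_iff (SetLike.GradeZero.subalgebra 𝒜).val
      Subtype.val_injective).1 h1.isIntegral⟩
  exact h (ringKrullDim_eq_zero_of_isField
    (isField_of_isIntegral_of_isField' (R := k) (Field.toIsField k)))

/-- If a polynomial expression in `t` with coefficients in `k` lies in `A` and is not constant,
then `t` is integral over `A`. -/
theorem isIntegral_of_aeval_eq_algebraMap {k A K : Type*} [Field k] [CommRing A] [Nontrivial A]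
    [Algebra k A] [CommRing K] [Algebra A K] [Algebra k K] [IsScalarTower k A K] {t : K} {a : A}
    {p : Polynomial k} (hp : p.natDegree ≠ 0) (h : Polynomial.aeval t p = algebraMap A K a) :
    IsIntegral A t := by
  have hp0 : p.leadingCoeff ≠ 0 := Polynomial.leadingCoeff_ne_zero.2 fun h0 ↦ hp (by simp [h0])
  refine IsIntegral.of_aeval_monic (p := (p * Polynomial.C p.leadingCoeff⁻¹).map (algebraMap k A))
    ((Polynomial.monic_mul_leadingCoeff_inv (Polynomial.leadingCoeff_ne_zero.1 hp0)).map _) ?_ ?_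
  · rwa [Polynomial.natDegree_map_eq_of_injective (algebraMap k A).injective,
      Polynomial.natDegree_mul_C (inv_ne_zero hp0)]
  · rw [Polynomial.aeval_map_algebraMap, map_mul, h, Polynomial.aeval_C,
      IsScalarTower.algebraMap_apply k A K, ← map_mul]
    exact isIntegral_algebraMap

/-- Let `A = ⊕_{i ∈ ℤ} A_i` be a `ℤ`-graded finitely generated normal domain
over `ℂ` of Krull dimension `2` with `A_0` of dimension `1` and `A_1 ≠ 0`, parabolic or
hyperbolic.  Let `D` be a nonzero homogeneous locally nilpotent `ℂ`-derivation of degree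
`e ≥ 0`, and `u ∈ A_1` nonzero with `D u = 0`.  Then there is `t ∈ A_0` such that the map
`ℂ[T,U] → A`, `T ↦ t`, `U ↦ u`, is injective with image the subalgebra `A_{≥0}` (so `A_{≥0}`
is a polynomial ring in `t, u`, and `A_0 = ℂ[t]`), and on `A_{≥0}` the derivation `D` equals
`x·∂/∂t` where `x := D t ∈ A_e`. -/
theorem parabolic_part_polynomial_ring_of_kernel_element_in_degree_one
    {A : Type*} [CommRing A] [IsDomain A] [Algebra ℂ A] [Algebra.FiniteType ℂ A]
    [IsIntegrallyClosed A]
    (𝒜 : ℤ → Submodule ℂ A) [GradedAlgebra 𝒜]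
    (hdim : ringKrullDim A = 2)
    (hdim0 : ringKrullDim (SetLike.GradeZero.subalgebra 𝒜) = 1)
    (hA1 : 𝒜 1 ≠ ⊥)
    (hcase : (∀ i : ℤ, i < 0 → 𝒜 i = ⊥) ∨ 𝒜 (-1) ≠ ⊥)
    (D : Derivation ℂ A A) (hD : D.IsLocallyNilpotent) (hne : D ≠ 0)
    (e : ℤ) (he : 0 ≤ e) (hhom : ∀ (n : ℤ), ∀ a ∈ 𝒜 n, D a ∈ 𝒜 (n + e))
    (u : A) (hu : u ∈ 𝒜 1) (hune : u ≠ 0) (hDu : D u = 0) :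
    ∃ t : A, t ∈ 𝒜 0 ∧
      Function.Injective (aeval (R := ℂ) ![t, u] : MvPolynomial (Fin 2) ℂ →ₐ[ℂ] A) ∧
      Set.range (aeval (R := ℂ) ![t, u] : MvPolynomial (Fin 2) ℂ →ₐ[ℂ] A) =
        ((⨆ n : ℕ, 𝒜 (n : ℤ)) : Submodule ℂ A) ∧
      ((𝒜 0 : Set A) = Set.range fun q : Polynomial ℂ => Polynomial.aeval t q) ∧
      D t ∈ 𝒜 e ∧
      ∀ p : MvPolynomial (Fin 2) ℂ,
        D (aeval ![t, u] p) = D t * aeval ![t, u] (pderiv 0 p) := by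
  lift e to ℕ using he
  let K := FractionRing A
  have hinj : Function.Injective (algebraMap A K) := IsFractionRing.injective A K
  have hu' : algebraMap A K u ≠ 0 := by simpa using hune
  have : CharZero K := charZero_of_injective_algebraMap (algebraMap ℂ K).injective
  have htr : Algebra.trdeg ℂ K ≤ 2 := by exact_mod_cast trdeg_fractionField_le (A := A) 2 hdim.le
  obtain ⟨E, hED⟩ := D.exists_extension_fractionField (K := K)
  have hE : E ≠ 0 := by
    rintro rfl
    exact hne (Derivation.ext fun a ↦ hinj (by simpa using (hED a).symm))
  have hker (w : K) (hw : w ∈ GradedAlgebra.awayDegreeZero K hu) (hEw : E w = 0) :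
      ∃ c : ℂ, algebraMap ℂ K c = w :=
    GradedAlgebra.exists_algebraMap_eq_of_derivation_eq_zero K htr E hu hune
      (by rw [hED, hDu, map_zero]) hE hw hEw
  obtain ⟨t, ht, hEt⟩ :=
    GradedAlgebra.exists_slice_awayDegreeZero hne hD hhom hED hu hune hDu hker
  have hpoly {n : ℕ} {f : A} (hf : f ∈ 𝒜 n) :
      ∃ p : Polynomial ℂ, algebraMap A K f = algebraMap A K u ^ n * Polynomial.aeval t p :=
    let ⟨l, hl⟩ := hD f
    GradedAlgebra.exists_eq_pow_mul_aeval hhom hED hu hune hDu hker ht hEt l hf hl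
  obtain ⟨a, ha, hat⟩ := GradedAlgebra.exists_transcendental_mem_zero 𝒜 (by simp [hdim0])
  obtain ⟨p, hp⟩ := hpoly (n := 0) ha
  rw [pow_zero, one_mul] at hp
  have haK : Transcendental ℂ (algebraMap A K a) :=
    (transcendental_algebraMap_iff hinj).2 hat
  have hp0 : p.natDegree ≠ 0 := by
    intro h0
    rw [hp, Polynomial.eq_C_of_natDegree_eq_zero h0, Polynomial.aeval_C] at haK
    exact haK (isAlgebraic_algebraMap _)
  have htt : Transcendental ℂ t := fun h ↦ haK <| hp ▸ IsIntegral.isAlgebraic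
    (Algebra.adjoin_singleton_le (S := integralClosure ℂ K) (IsAlgebraic.isIntegral h)
      (Polynomial.aeval_mem_adjoin_singleton ℂ t))
  obtain ⟨s, rfl⟩ := IsIntegrallyClosed.isIntegral_iff.1
    (isIntegral_of_aeval_eq_algebraMap (A := A) hp0 hp.symm)
  have hs : s ∈ 𝒜 0 := by
    obtain ⟨m, g, hg, h⟩ := ht
    rw [← map_pow, ← map_mul] at h
    refine GradedAlgebra.mem_of_mul_mem 𝒜 (m := m) (x := u ^ m) ?_ (pow_ne_zero m hune) ?_
    · simpa using SetLike.pow_mem_graded m hu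
    · rwa [hinj h, add_zero]
  have hpolyA {n : ℕ} {f : A} (hf : f ∈ 𝒜 n) :
      ∃ p : Polynomial ℂ, f = u ^ n * Polynomial.aeval s p := by
    obtain ⟨p, hp⟩ := hpoly hf
    refine ⟨p, hinj ?_⟩
    rw [hp, map_mul, map_pow, Polynomial.aeval_algebraMap_apply]
  refine ⟨s, hs, ?_, ?_, ?_, by simpa using hhom 0 s hs,
    MvPolynomial.derivation_aeval_pair D s hDu⟩
  · have h1 := (GradedAlgebra.algebraicIndependent_option K hu hune ht htt).comp
      ![some (), none] (by decide)
    have h3 : AlgebraicIndependent ℂ ![s, u] := by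
      refine AlgebraicIndependent.of_comp (IsScalarTower.toAlgHom ℂ A K) ?_
      have h2 : IsScalarTower.toAlgHom ℂ A K ∘ ![s, u] =
          (fun o : Option Unit ↦ o.elim (algebraMap A K u) fun _ ↦ algebraMap A K s) ∘
            ![some (), none] := by
        ext i
        fin_cases i <;> rfl
      rw [h2]
      exact h1
    exact algebraicIndependent_iff_injective_aeval.1 h3
  · refine Set.Subset.antisymm ?_ ?_
    · rintro _ ⟨q, rfl⟩
      exact GradedAlgebra.aeval_pair_mem_iSup 𝒜 hs hu q
    · refine (iSup_le fun n f hf ↦ ?_ :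
        (⨆ n : ℕ, 𝒜 (n : ℤ)) ≤ (aeval (R := ℂ) ![s, u]).range.toSubmodule)
      obtain ⟨p, rfl⟩ := hpolyA hf
      refine ⟨X 1 ^ n * Polynomial.aeval (X 0) p, ?_⟩
      simp [← Polynomial.aeval_algHom_apply]
  · refine Set.Subset.antisymm ?_ ?_
    · intro f hf
      obtain ⟨p, hp⟩ := hpolyA (n := 0) hf
      exact ⟨p, by simpa using hp.symm⟩
    · rintro _ ⟨q, rfl⟩
      exact Algebra.adjoin_singleton_le (S := SetLike.GradeZero.subalgebra 𝒜) hs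
        (Polynomial.aeval_mem_adjoin_singleton ℂ s)
end

section
/- Let A = ⊕_{i≥0} A_i be a positively graded finitely generated normal integral domain over ℂ of Krull dimension 2 with A_0 of Krull dimension 1 and A_1 ≠ 0 (a parabolic graded algebra). If A admits a nonzero homogeneous locally nilpotent ℂ-derivation ∂ of degree 0, then there is a graded ℂ-algebra isomorphism A ≅ ℂ[t,u] onto the polynomial ring in two variables with deg t = 0 and deg u = 1, under which ∂ corresponds to ∂/∂t. -/
open MvPolynomial

open Polynomial in
/-- Over a domain of characteristic zero, an element not killed by a derivation `D` is
transcendental over any subalgebra of the kernel of `D`. -/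
theorem Derivation.transcendental_of_apply_ne_zero_s17 {A : Type*} [CommRing A] [IsDomain A]
    [Algebra ℂ A] (D : Derivation ℂ A A) (B : Subalgebra ℂ A) (hB : ∀ b ∈ B, D b = 0)
    {s : A} (hs : D s ≠ 0) : Transcendental B s := by
  let D' : Derivation B A A := Derivation.mk'
    { toFun := D
      map_add' := map_add D
      map_smul' := fun b x ↦ by simp [Subalgebra.smul_def, hB b b.2] }
    fun a b ↦ D.leibniz a b
  have hD' : ∀ x, D' x = D x := fun _ ↦ rfl
  have : CharZero A := charZero_of_injective_algebraMap (algebraMap ℂ A).injective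
  rw [transcendental_iff]
  intro q
  induction hn : q.natDegree using Nat.strong_induction_on generalizing q with
  | _ n ih =>
  intro hq
  have hder : aeval s (derivative q) = 0 := by
    have h := D'.map_aeval q s
    rw [hq, map_zero, hD', smul_eq_mul] at h
    exact (mul_eq_zero.mp h.symm).resolve_right hs
  have hdeg : q.natDegree = 0 := by
    by_contra hne
    have hlt := natDegree_derivative_lt hne
    exact hne (derivative_eq_zero.mp (ih _ (hn ▸ hlt) _ rfl hder))
  rw [eq_C_of_natDegree_eq_zero hdeg] at hq ⊢
  rw [Polynomial.aeval_C] at hq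
  rw [show q.coeff 0 = 0 from Subtype.ext hq, Polynomial.C_0]

/-- Evaluating a polynomial at homogeneous elements sends its weighted homogeneous components to
the graded components of its value. -/
theorem GradedAlgebra.proj_aeval {ι σ A : Type*} [DecidableEq ι] [AddCommMonoid ι] [CommRing A]
    [Algebra ℂ A] (𝒜 : ι → Submodule ℂ A) [GradedAlgebra 𝒜] {w : σ → ι} {v : σ → A}
    (hv : ∀ i, v i ∈ 𝒜 (w i)) (m : ι) (P : MvPolynomial σ ℂ) :
    GradedAlgebra.proj 𝒜 m (aeval v P) = aeval v (weightedHomogeneousComponent w m P) := by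
  induction P using MvPolynomial.induction_on' with
  | add p q hp hq => simp only [map_add, hp, hq]
  | monomial d c =>
    have hmem : aeval v (monomial d c) ∈ 𝒜 (Finsupp.weight w d) := by
      rw [aeval_monomial, ← Algebra.smul_def, Finsupp.weight_apply]
      refine Submodule.smul_mem _ _ ?_
      exact SetLike.prod_mem_graded (A := 𝒜) (fun i ↦ d i • w i) (fun i ↦ v i ^ d i)
        fun i _ ↦ SetLike.pow_mem_graded _ (hv i)
    have hw := isWeightedHomogeneous_monomial w d c rfl
    rw [GradedAlgebra.proj_apply]
    by_cases h : m = Finsupp.weight w d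
    · subst h
      rw [hw.weightedHomogeneousComponent_same, DirectSum.decompose_of_mem_same _ hmem]
    · rw [hw.weightedHomogeneousComponent_ne _ h, map_zero,
        DirectSum.decompose_of_mem_ne _ hmem (Ne.symm h)]

/-- In a graded domain over `ℂ`, a homogeneous element of degree `n` algebraically dependent on a
nonzero element `u` of degree `1` is a scalar multiple of `u ^ n`. -/
theorem GradedAlgebra.exists_eq_smul_pow {A : Type*} [CommRing A] [IsDomain A] [Algebra ℂ A]
    (𝒜 : ℤ → Submodule ℂ A) [GradedAlgebra 𝒜] {n : ℕ} {f u : A} (hf : f ∈ 𝒜 n) (hu : u ∈ 𝒜 1)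
    (hu0 : u ≠ 0) (hdep : ¬ AlgebraicIndependent ℂ ![f, u]) : ∃ c : ℂ, f = c • u ^ n := by
  let w : Fin 2 → ℤ := ![n, 1]
  obtain ⟨m, Q, hQ0, hQw, hQ⟩ : ∃ (m : ℤ) (Q : MvPolynomial (Fin 2) ℂ), Q ≠ 0 ∧
      Q.IsWeightedHomogeneous w m ∧ aeval ![f, u] Q = 0 := by
    rw [algebraicIndependent_iff] at hdep
    push Not at hdep
    obtain ⟨P, hP, hP0⟩ := hdep
    obtain ⟨m, hm⟩ : ∃ m, weightedHomogeneousComponent w m P ≠ 0 := by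
      by_contra! h
      apply hP0
      rw [← sum_weightedHomogeneousComponent w P]
      simp [h]
    refine ⟨m, _, hm, weightedHomogeneousComponent_isWeightedHomogeneous _ _, ?_⟩
    rw [← GradedAlgebra.proj_aeval 𝒜 (w := w), hP, map_zero]
    intro i
    fin_cases i <;> simpa [w]
  have hwt : ∀ d ∈ Q.support, (d 0 : ℤ) * n + d 1 = m := fun d hd ↦ by
    simpa [Finsupp.weight_apply, Finsupp.sum_fintype, w] using hQw (MvPolynomial.mem_support_iff.mp hd)
  let K := FractionRing A
  let f' : K := algebraMap A K f
  let u' : K := algebraMap A K u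
  have hu' : u' ≠ 0 := by simpa [u'] using hu0
  let r : K := f' / u' ^ n
  have hfr : f' = r * u' ^ n := (div_mul_cancel₀ _ (pow_ne_zero n hu')).symm
  let q : Polynomial ℂ := ∑ d ∈ Q.support, Polynomial.monomial (d 0) (Q.coeff d)
  have hq0 : q ≠ 0 := by
    obtain ⟨d, hd⟩ := support_nonempty.mpr hQ0
    intro h
    have hc := congrArg (fun p ↦ p.coeff (d 0)) h
    simp only [q, Polynomial.finsetSum_coeff, Polynomial.coeff_monomial,
      Polynomial.coeff_zero] at hc
    rw [Finset.sum_eq_single d] at hc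
    · exact MvPolynomial.mem_support_iff.mp hd (by simpa using hc)
    · intro e he hne
      refine if_neg fun h0 ↦ hne ?_
      have h1 := hwt e he
      have h2 := hwt d hd
      rw [h0] at h1
      ext i
      fin_cases i
      · exact h0
      · have : (e 1 : ℤ) = d 1 := by linarith
        exact_mod_cast this
    · exact fun h ↦ absurd hd h
  have hqr : Polynomial.aeval r q = 0 := by
    have h : algebraMap A K (aeval ![f, u] Q) = u' ^ m * Polynomial.aeval r q := by
      rw [← MvPolynomial.aeval_algebraMap_apply, aeval_def, eval₂_eq', map_sum, Finset.mul_sum]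
      refine Finset.sum_congr rfl fun d hd ↦ ?_
      rw [← hwt d hd, zpow_add₀ hu', zpow_mul', Polynomial.aeval_monomial]
      simp only [Fin.prod_univ_two, Function.comp, Matrix.cons_val_zero, Matrix.cons_val_one]
      change _ * (f' ^ d 0 * u' ^ d 1) = _
      rw [hfr, mul_pow, zpow_natCast, zpow_natCast, zpow_natCast]
      ring
    rw [hQ, map_zero] at h
    exact (mul_eq_zero.mp h.symm).resolve_left (zpow_ne_zero _ hu')
  obtain ⟨c, hc⟩ : ∃ c : ℂ, algebraMap ℂ K c = r := by
    have := IntermediateField.isAlgebraic_adjoin_simple (IsAlgebraic.isIntegral ⟨q, hq0, hqr⟩)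
    have hr := IntermediateField.mem_adjoin_simple_self ℂ r
    rwa [IntermediateField.eq_bot_of_isAlgClosed_of_isAlgebraic (IntermediateField.adjoin ℂ {r}),
      IntermediateField.mem_bot] at hr
  refine ⟨c, IsFractionRing.injective A K ?_⟩
  rw [Algebra.smul_def, map_mul, map_pow, ← IsScalarTower.algebraMap_apply, hc]
  exact hfr

/-- An injective integral extension does not lower the Krull dimension. -/
theorem ringKrullDim_le_of_isIntegral_of_injective {R S : Type*} [CommRing R] [CommRing S]
    [Algebra R S] [Algebra.IsIntegral R S] (h : Function.Injective (algebraMap R S)) :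
    ringKrullDim R ≤ ringKrullDim S := by
  refine iSup_le fun l ↦ ?_
  obtain ⟨Q, -, hQ, hQl⟩ := Ideal.exists_ideal_over_prime_of_isIntegral l.head.asIdeal (⊥ : Ideal S)
    (by rw [← RingHom.ker_eq_comap_bot, (RingHom.injective_iff_ker_eq_bot _).mp h]; exact bot_le)
  have : Q.LiesOver l.head.asIdeal := (Ideal.liesOver_iff _ _).mpr hQl.symm
  obtain ⟨L, hL, -⟩ := Ideal.exists_ltSeries_of_hasGoingUp l Q
  rw [← hL]
  exact le_iSup (fun L : LTSeries (PrimeSpectrum S) ↦ (L.length : WithBot ℕ∞)) L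

/-- Algebraically independent families in a finitely generated domain have at most as many members
as its Krull dimension. -/
theorem AlgebraicIndependent.card_le_ringKrullDim {A ι : Type*} [CommRing A] [IsDomain A]
    [Algebra ℂ A] [Algebra.FiniteType ℂ A] [Fintype ι] {x : ι → A}
    (hx : AlgebraicIndependent ℂ x) : (Fintype.card ι : WithBot ℕ∞) ≤ ringKrullDim A := by
  obtain ⟨k, g, hg, hgi⟩ := exists_integral_inj_algHom_of_fg ℂ A
  let a := g.toRingHom.toAlgebra
  have : IsScalarTower ℂ (MvPolynomial (Fin k) ℂ) A :=
    IsScalarTower.of_algebraMap_eq fun c ↦ (g.commutes c).symm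
  have hinj : Function.Injective (algebraMap (MvPolynomial (Fin k) ℂ) A) := hg
  have : Algebra.IsIntegral (MvPolynomial (Fin k) ℂ) A := ⟨hgi⟩
  have hk : (k : WithBot ℕ∞) ≤ ringKrullDim A := by
    simpa using ringKrullDim_le_of_isIntegral_of_injective hinj
  refine le_trans ?_ hk
  have : FaithfulSMul (MvPolynomial (Fin k) ℂ) A :=
    (faithfulSMul_iff_algebraMap_injective _ _).mpr hinj
  have hb : IsTranscendenceBasis ℂ (algebraMap _ A ∘ (X : Fin k → MvPolynomial (Fin k) ℂ)) :=
    (IsTranscendenceBasis.mvPolynomial (Fin k) ℂ).algebraMap_comp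
  have h1 := hx.lift_cardinalMk_le_trdeg
  have h2 := hb.lift_cardinalMk_eq_trdeg
  simp only [Cardinal.mk_fintype, Cardinal.lift_natCast, Fintype.card_fin] at h1 h2
  rw [Cardinal.lift_id'] at h2
  rw [← h2, Cardinal.lift_natCast] at h1
  exact_mod_cast h1

/-- In characteristic zero every polynomial has an antiderivative in each variable. -/
theorem MvPolynomial.pderiv_surjective {σ : Type*} (i : σ) :
    Function.Surjective (pderiv i : MvPolynomial σ ℂ → MvPolynomial σ ℂ) := by
  intro P
  induction P using MvPolynomial.induction_on' with
  | add p q hp hq =>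
    obtain ⟨p, rfl⟩ := hp
    obtain ⟨q, rfl⟩ := hq
    exact ⟨p + q, map_add _ _ _⟩
  | monomial d c =>
    refine ⟨monomial (d + Finsupp.single i 1) (c / (d i + 1)), ?_⟩
    have : (d i + 1 : ℂ) ≠ 0 := by exact_mod_cast (d i).succ_ne_zero
    simp [pderiv_monomial, this]

/-- The orbit of a nonzero element under a locally nilpotent derivation contains a nonzero element
of the kernel. -/
theorem Derivation.IsLocallyNilpotent.exists_iterate_ne_zero {A : Type*} [CommRing A] [Algebra ℂ A]
    {D : Derivation ℂ A A} (hD : D.IsLocallyNilpotent) {x : A} (hx : x ≠ 0) :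
    ∃ k, D^[k] x ≠ 0 ∧ D (D^[k] x) = 0 := by
  classical
  have h := hD x
  obtain ⟨k, hk⟩ : ∃ k, Nat.find h = k + 1 :=
    Nat.exists_eq_succ_of_ne_zero fun h0 ↦ hx (by simpa [h0] using Nat.find_spec h)
  refine ⟨k, Nat.find_min h (by omega), ?_⟩
  rw [← Function.iterate_succ_apply' D, ← Nat.add_one, ← hk]
  exact Nat.find_spec h

/-- A homogeneous derivation of degree `0` commutes with the projections onto graded pieces. -/
theorem Derivation.apply_proj {A : Type*} [CommRing A] [Algebra ℂ A] (𝒜 : ℤ → Submodule ℂ A)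
    [GradedAlgebra 𝒜] (D : Derivation ℂ A A) (hhom : ∀ n, ∀ a ∈ 𝒜 n, D a ∈ 𝒜 n) (i : ℤ) (f : A) :
    D (GradedAlgebra.proj 𝒜 i f) = GradedAlgebra.proj 𝒜 i (D f) := by
  induction f using DirectSum.Decomposition.inductionOn 𝒜 with
  | zero => simp
  | add p q hp hq => simp only [map_add, hp, hq]
  | @homogeneous j a =>
    simp only [GradedAlgebra.proj_apply]
    by_cases h : j = i
    · subst h
      rw [DirectSum.decompose_of_mem_same _ a.2, DirectSum.decompose_of_mem_same _ (hhom _ _ a.2)]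
    · rw [DirectSum.decompose_of_mem_ne _ a.2 h, DirectSum.decompose_of_mem_ne _ (hhom _ _ a.2) h,
        map_zero]

/-- Let `A = ⊕_{i ≥ 0} A_i` be a parabolic graded finitely generated normal
domain over `ℂ` of Krull dimension `2` (positively graded, `A_0` of Krull dimension `1`,
`A_1 ≠ 0`).  If `A` admits a nonzero homogeneous locally nilpotent `ℂ`-derivation `D` of degree
`0`, then there is a graded `ℂ`-algebra isomorphism `A ≅ ℂ[t,u]` (with `deg t = 0`,
`deg u = 1`, expressed via weighted homogeneity with weights `(0,1)`) carrying `D` to `∂/∂t`. -/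
theorem parabolic_with_degree_zero_lnd_is_plane
    {A : Type*} [CommRing A] [IsDomain A] [Algebra ℂ A] [Algebra.FiniteType ℂ A]
    [IsIntegrallyClosed A]
    (𝒜 : ℤ → Submodule ℂ A) [GradedAlgebra 𝒜]
    (hpos : ∀ i : ℤ, i < 0 → 𝒜 i = ⊥)
    (hdim : ringKrullDim A = 2)
    (hdim0 : ringKrullDim (SetLike.GradeZero.subalgebra 𝒜) = 1)
    (hA1 : 𝒜 1 ≠ ⊥)
    (D : Derivation ℂ A A) (hD : D.IsLocallyNilpotent) (hne : D ≠ 0)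
    (hhom : ∀ (n : ℤ), ∀ a ∈ 𝒜 n, D a ∈ 𝒜 n) :
    ∃ φ : A ≃ₐ[ℂ] MvPolynomial (Fin 2) ℂ,
      (∀ (n : ℤ) (a : A), a ∈ 𝒜 n ↔ (φ a).IsWeightedHomogeneous ![(0 : ℤ), 1] n) ∧
      ∀ a : A, φ (D a) = pderiv 0 (φ a) := by
  obtain ⟨x₁, hx₁, hx₁0⟩ := Submodule.exists_mem_ne_zero_of_ne_bot hA1
  have hiter : ∀ (n : ℤ) (k : ℕ), ∀ a ∈ 𝒜 n, D^[k] a ∈ 𝒜 n := fun n k a ha ↦ by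
    induction k with
    | zero => exact ha
    | succ k ih => rw [Function.iterate_succ_apply']; exact hhom _ _ ih
  obtain ⟨k, hk0, hk⟩ := hD.exists_iterate_ne_zero hx₁0
  obtain ⟨u, hu, hu0, hDu⟩ : ∃ u ∈ 𝒜 1, u ≠ 0 ∧ D u = 0 := ⟨_, hiter 1 k _ hx₁, hk0, hk⟩
  obtain ⟨z, hz⟩ : ∃ z, D z ≠ 0 := by
    by_contra! h
    exact hne (Derivation.ext h)
  have hker : ∀ (n : ℕ), ∀ f ∈ 𝒜 n, D f = 0 → ∃ c : ℂ, f = c • u ^ n := by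
    intro n f hf hDf
    refine GradedAlgebra.exists_eq_smul_pow 𝒜 hf hu hu0 fun hind ↦ ?_
    have hadj : ∀ b ∈ Algebra.adjoin ℂ (Set.range ![f, u]), D b = 0 := fun b hb ↦ by
      refine Derivation.eqOn_adjoin (D1 := D) (D2 := 0) ?_ hb
      rintro - ⟨i, rfl⟩
      fin_cases i <;> simpa
    have h := ((hind.option_iff_transcendental z).mpr
      (D.transcendental_of_apply_ne_zero_s17 _ hadj hz)).card_le_ringKrullDim
    rw [hdim, Fintype.card_option, Fintype.card_fin] at h
    exact absurd h (by decide)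
  obtain ⟨s, hs, hDs⟩ : ∃ s ∈ 𝒜 0, D s = 1 := by
    obtain ⟨y, hy, hDy⟩ : ∃ y ∈ 𝒜 0, D y ≠ 0 := by
      by_contra! h
      have hsurj : Function.Surjective (algebraMap ℂ (SetLike.GradeZero.subalgebra 𝒜)) := by
        rintro ⟨a, ha⟩
        obtain ⟨c, hc⟩ := hker 0 a ha (h a ha)
        refine ⟨c, Subtype.ext ?_⟩
        change algebraMap ℂ A c = a
        rw [hc, pow_zero, ← Algebra.algebraMap_eq_smul_one]
      have := ringKrullDim_le_of_surjective _ hsurj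
      rw [hdim0, ringKrullDim_eq_zero_of_field] at this
      exact absurd this (by decide)
    obtain ⟨k, hk0, hk⟩ := hD.exists_iterate_ne_zero hDy
    obtain ⟨c, hc⟩ := hker 0 _ (hiter 0 k _ (hhom 0 y hy)) hk
    rw [pow_zero] at hc
    have hc0 : c ≠ 0 := fun h ↦ hk0 (by rw [hc, h, zero_smul])
    refine ⟨c⁻¹ • D^[k] y, Submodule.smul_mem _ _ (hiter 0 k y hy), ?_⟩
    rw [D.map_smul, ← Function.iterate_succ_apply' D, Function.iterate_succ_apply, hc, smul_smul,
      inv_mul_cancel₀ hc0, one_smul]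
  let ψ : MvPolynomial (Fin 2) ℂ →ₐ[ℂ] A := aeval ![s, u]
  have hψ0 : ψ (X 0) = s := by simp [ψ]
  have hψ1 : ψ (X 1) = u := by simp [ψ]
  have hψD : ∀ P, D (ψ P) = ψ (pderiv 0 P) := by
    intro P
    induction P using MvPolynomial.induction_on with
    | C a => simp [ψ]
    | add p q hp hq => simp only [map_add, hp, hq]
    | mul_X p i hp =>
      rw [map_mul, Derivation.leibniz, Derivation.leibniz, hp]
      fin_cases i
      · simp [hψ0, hDs]
      · simp [hψ1, hDu]
  have hsurj : Function.Surjective ψ := by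
    have hkerD : ∀ f, D f = 0 → f ∈ ψ.range := by
      classical
      intro f hf
      rw [← DirectSum.sum_support_decompose 𝒜 f]
      refine sum_mem fun i _ ↦ ?_
      by_cases hi : i < 0
      · have h := (DirectSum.decompose 𝒜 f i).2
        rw [(Submodule.eq_bot_iff _).mp (hpos i hi) _ h]
        exact zero_mem _
      · obtain ⟨n, rfl⟩ := Int.eq_ofNat_of_zero_le (not_lt.mp hi)
        have h := D.apply_proj 𝒜 hhom n f
        rw [hf, map_zero] at h
        obtain ⟨c, hc⟩ := hker n _ (DirectSum.decompose 𝒜 f n).2 h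
        exact ⟨c • X 1 ^ n, by rw [hc, ← hψ1]; simp⟩
    intro f
    obtain ⟨n, hn⟩ := hD f
    induction n generalizing f with
    | zero => exact ⟨0, by rw [map_zero]; exact hn.symm⟩
    | succ n ih =>
      obtain ⟨P, hP⟩ := ih (D f) hn
      obtain ⟨Q, rfl⟩ := pderiv_surjective 0 P
      obtain ⟨R, hR⟩ := hkerD (f - ψ Q) (by rw [map_sub, hψD, hP, sub_self])
      exact ⟨R + Q, by rw [map_add]; exact eq_sub_iff_add_eq.mp hR⟩
  have hinj : Function.Injective ψ := by
    rw [injective_iff_map_eq_zero]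
    intro P hP
    by_contra hP0
    have h := ringKrullDim_succ_le_of_surjective ψ.toRingHom hsurj
      (mem_nonZeroDivisors_of_ne_zero hP0) hP
    rw [hdim, MvPolynomial.ringKrullDim_of_isNoetherianRing, ringKrullDim_eq_zero_of_field] at h
    simp at h
    exact absurd h (by decide)
  let e := AlgEquiv.ofBijective ψ ⟨hinj, hsurj⟩
  have he : ∀ P, e P = ψ P := fun _ ↦ rfl
  have hproj : ∀ (n : ℤ) P, GradedAlgebra.proj 𝒜 n (ψ P) =
      ψ (weightedHomogeneousComponent ![(0 : ℤ), 1] n P) :=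
    GradedAlgebra.proj_aeval 𝒜 (fun i ↦ by fin_cases i <;> simpa)
  refine ⟨e.symm, fun n a ↦ ?_, fun a ↦ ?_⟩
  · obtain ⟨P, rfl⟩ := e.surjective a
    rw [e.symm_apply_apply, he]
    constructor
    · intro h
      have h1 := hproj n P
      rw [GradedAlgebra.proj_apply, DirectSum.decompose_of_mem_same _ h] at h1
      rw [hinj h1]
      exact weightedHomogeneousComponent_isWeightedHomogeneous _ _
    · intro h
      rw [← h.weightedHomogeneousComponent_same, ← hproj]
      exact (DirectSum.decompose 𝒜 (ψ P) n).2
  · obtain ⟨P, rfl⟩ := e.surjective a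
    rw [e.symm_apply_apply, e.symm_apply_eq, he, he, hψD]
end

section
/- Let P ∈ ℂ[t] be a monic nonconstant polynomial, let e ≥ 1 be an integer, and let B = ℂ[t,u₊,u₋]/(u₊u₋ − P(t)). The ℂ-derivation of ℂ[t,u₊,u₋] determined by δ(u₊) = 0, δ(t) = u₊^e and δ(u₋) = P'(t)·u₊^{e−1} annihilates u₊u₋ − P(t) and hence descends to a ℂ-derivation ∂₊ of B; this derivation ∂₊ is locally nilpotent, and its kernel is ℂ[u₊], the ℂ-subalgebra of B generated by (the class of) u₊. -/
open MvPolynomial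

section LocallyNilpotent

variable {K B : Type*} [Field K] [CommRing B] [Algebra K B] (D : Derivation K B B)

theorem Derivation.iterate_eq_zero_of_le_s19 {x : B} {n m : ℕ} (h : (⇑D)^[n] x = 0) (hnm : n ≤ m) :
    (⇑D)^[m] x = 0 := by
  obtain ⟨k, rfl⟩ := Nat.exists_eq_add_of_le' hnm
  rw [Function.iterate_add_apply, h, iterate_map_zero]

theorem Derivation.iterate_mul_eq_zero_s19 {x y : B} {n m : ℕ} (hx : (⇑D)^[n] x = 0)
    (hy : (⇑D)^[m] y = 0) : (⇑D)^[n + m] (x * y) = 0 := by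
  induction hk : n + m generalizing x y n m with
  | zero =>
    obtain ⟨rfl, rfl⟩ : n = 0 ∧ m = 0 := by omega
    simp_all
  | succ k ih =>
    rcases n with _ | n
    · simp only [Function.iterate_zero, id_eq] at hx
      rw [hx, zero_mul, iterate_map_zero]
    rcases m with _ | m
    · simp only [Function.iterate_zero, id_eq] at hy
      rw [hy, mul_zero, iterate_map_zero]
    rw [Function.iterate_succ_apply, D.leibniz, iterate_map_add, smul_eq_mul, smul_eq_mul,
      ih hx (by simpa using hy) (by omega : (n + 1) + m = k),
      ih hy (by simpa using hx) (by omega : (m + 1) + n = k), add_zero]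

/-- The subalgebra of elements killed by some power of a derivation. -/
def Derivation.nilSubalgebra_s19 : Subalgebra K B where
  carrier := {x | ∃ n : ℕ, (⇑D)^[n] x = 0}
  mul_mem' := fun ⟨n, hn⟩ ⟨m, hm⟩ => ⟨n + m, D.iterate_mul_eq_zero_s19 hn hm⟩
  add_mem' := fun ⟨n, hn⟩ ⟨m, hm⟩ => ⟨n + m, by
    rw [iterate_map_add, D.iterate_eq_zero_of_le_s19 hn (Nat.le_add_right n m),
      D.iterate_eq_zero_of_le_s19 hm (Nat.le_add_left m n), add_zero]⟩
  algebraMap_mem' r := ⟨1, by simp⟩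

theorem Derivation.iterate_mul_of_apply_eq_zero {u : B} (hu : D u = 0) (x : B) (n : ℕ) :
    (⇑D)^[n] (u * x) = u * (⇑D)^[n] x := by
  induction n generalizing x with
  | zero => rfl
  | succ n ih => simp [D.leibniz, hu, ih]

variable {D} {t u v : B} {e : ℕ} {P : Polynomial K}

theorem Derivation.exists_iterate_eq_zero_of_generators
    (hgen : Algebra.adjoin K {t, u, v} = ⊤) (huv : u * v = Polynomial.aeval t P)
    (hu : ∀ x, u * x = 0 → x = 0) (hDu : D u = 0) (hDt : D t = u ^ e) (x : B) :
    ∃ n : ℕ, (⇑D)^[n] x = 0 := by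
  have ht : t ∈ D.nilSubalgebra_s19 := ⟨2, by simp [hDt, D.leibniz_pow, hDu]⟩
  have hP : u * v ∈ D.nilSubalgebra_s19 := by
    rw [huv]
    exact Algebra.adjoin_le (Set.singleton_subset_iff.2 ht)
      (Polynomial.aeval_mem_adjoin_singleton K t)
  obtain ⟨n, hn⟩ := hP
  rw [D.iterate_mul_of_apply_eq_zero hDu] at hn
  have hle : Algebra.adjoin K {t, u, v} ≤ D.nilSubalgebra_s19 := by
    refine Algebra.adjoin_le ?_
    rintro y (rfl | rfl | rfl)
    · exact ht
    · exact ⟨1, hDu⟩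
    · exact ⟨n, hu _ hn⟩
  exact hle (hgen ▸ Algebra.mem_top)

/-- The evaluation `K[u][t] → B` at two elements of `B`. -/
noncomputable def biEval (K : Type*) {B : Type*} [Field K] [CommRing B] [Algebra K B] (t u : B) :
    Polynomial (Polynomial K) →+* B :=
  Polynomial.eval₂RingHom (Polynomial.aeval u).toRingHom t

@[simp]
theorem biEval_C (p : Polynomial K) : biEval K t u (Polynomial.C p) = Polynomial.aeval u p := by
  simp [biEval]

@[simp]
theorem biEval_X : biEval K t u Polynomial.X = t := by
  simp [biEval]

theorem Derivation.apply_aeval_eq_zero (hDu : D u = 0) (p : Polynomial K) :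
    D (Polynomial.aeval u p) = 0 := by
  rw [D.map_aeval, hDu, smul_zero]

theorem Derivation.apply_biEval (hDu : D u = 0) (g : Polynomial (Polynomial K)) :
    D (biEval K t u g) = biEval K t u (Polynomial.derivative g) * D t := by
  induction g using Polynomial.induction_on' with
  | add p q hp hq => simp [hp, hq, add_mul]
  | monomial n a =>
    rw [← Polynomial.C_mul_X_pow_eq_monomial, Polynomial.derivative_C_mul_X_pow]
    simp [D.leibniz, D.leibniz_pow, apply_aeval_eq_zero hDu, mul_assoc]

theorem map_biEval (φ : B →ₐ[K] K) (g : Polynomial (Polynomial K)) :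
    φ (biEval K t u g) = (g.eval (Polynomial.C (φ t))).eval (φ u) := by
  induction g using Polynomial.induction_on' with
  | add p q hp hq => simp [hp, hq]
  | monomial n a =>
    rw [← Polynomial.C_mul_X_pow_eq_monomial]
    simp [← Polynomial.aeval_algHom_apply, Polynomial.coe_aeval_eq_eval]

theorem biEval_injective [Infinite K]
    (hpt : ∀ a b : K, b ≠ 0 → ∃ φ : B →ₐ[K] K, φ t = a ∧ φ u = b) :
    Function.Injective (biEval K t u) := by
  refine (injective_iff_map_eq_zero _).2 fun g hg => ?_
  have hroot (a : K) : g.eval (Polynomial.C a) = 0 := by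
    have : Polynomial.X * g.eval (Polynomial.C a) = 0 := by
      refine Polynomial.funext fun b => ?_
      rcases eq_or_ne b 0 with rfl | hb
      · simp
      · obtain ⟨φ, rfl, rfl⟩ := hpt a b hb
        simp [← map_biEval, hg]
    exact (mul_eq_zero.1 this).resolve_left Polynomial.X_ne_zero
  refine Polynomial.eq_zero_of_infinite_isRoot g
    ((Set.infinite_range_of_injective Polynomial.C_injective).mono ?_)
  rintro _ ⟨a, rfl⟩
  exact hroot a

theorem exists_pow_mul_eq_biEval (hgen : Algebra.adjoin K {t, u, v} = ⊤)
    (huv : u * v = Polynomial.aeval t P) (x : B) :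
    ∃ (n : ℕ) (g : Polynomial (Polynomial K)), u ^ n * x = biEval K t u g := by
  have hx : x ∈ Algebra.adjoin K {t, u, v} := hgen ▸ Algebra.mem_top
  have hu : biEval K t u (Polynomial.C Polynomial.X) = u := by simp
  induction hx using Algebra.adjoin_induction with
  | mem y hy =>
    rcases hy with rfl | rfl | rfl
    · exact ⟨0, Polynomial.X, by simp⟩
    · exact ⟨0, Polynomial.C Polynomial.X, by simp⟩
    · refine ⟨1, P.map Polynomial.C, ?_⟩
      rw [pow_one, huv, biEval, Polynomial.coe_eval₂RingHom, Polynomial.eval₂_map,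
        Polynomial.aeval_def]
      congr 1
      ext r
      simp
  | algebraMap r => exact ⟨0, Polynomial.C (Polynomial.C r), by simp⟩
  | add y z _ _ hy hz =>
    obtain ⟨n, g, hg⟩ := hy
    obtain ⟨m, h, hh⟩ := hz
    refine ⟨n + m, Polynomial.C Polynomial.X ^ m * g + Polynomial.C Polynomial.X ^ n * h, ?_⟩
    rw [map_add, map_mul, map_mul, map_pow, map_pow, hu, ← hg, ← hh]
    ring
  | mul y z _ _ hy hz =>
    obtain ⟨n, g, hg⟩ := hy
    obtain ⟨m, h, hh⟩ := hz
    refine ⟨n + m, g * h, ?_⟩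
    rw [map_mul, ← hg, ← hh]
    ring

theorem mem_adjoin_of_pow_mul_eq_aeval (hu : ∀ x, u * x = 0 → x = 0)
    (hpt : ∃ φ : B →ₐ[K] K, φ u = 0) {x : B} (n : ℕ) (p : Polynomial K)
    (h : u ^ n * x = Polynomial.aeval u p) : x ∈ Algebra.adjoin K {u} := by
  induction n generalizing p with
  | zero =>
    rw [pow_zero, one_mul] at h
    exact h ▸ Polynomial.aeval_mem_adjoin_singleton K u
  | succ n ih =>
    obtain ⟨φ, hφ⟩ := hpt
    have h0 : p.eval 0 = 0 := by
      have := congrArg φ h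
      rw [← Polynomial.aeval_algHom_apply, hφ] at this
      simpa [hφ, Polynomial.coe_aeval_eq_eval] using this.symm
    obtain ⟨q, rfl⟩ : Polynomial.X ∣ p := Polynomial.X_dvd_iff.2 (by
      rwa [Polynomial.coeff_zero_eq_eval_zero])
    refine ih q (sub_eq_zero.1 (hu _ ?_))
    rw [map_mul, Polynomial.aeval_X] at h
    rw [mul_sub, ← h]
    ring

theorem Derivation.apply_eq_zero_iff_mem_adjoin [CharZero K]
    (hgen : Algebra.adjoin K {t, u, v} = ⊤) (huv : u * v = Polynomial.aeval t P)
    (hu : ∀ x, u * x = 0 → x = 0) (hDu : D u = 0) (hDt : D t = u ^ e)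
    (hpt : ∀ a b : K, b ≠ 0 → ∃ φ : B →ₐ[K] K, φ t = a ∧ φ u = b)
    (hpt₀ : ∃ φ : B →ₐ[K] K, φ u = 0) (x : B) :
    D x = 0 ↔ x ∈ Algebra.adjoin K {u} := by
  constructor
  · intro hx
    obtain ⟨n, g, hg⟩ := exists_pow_mul_eq_biEval hgen huv x
    have hpow (m : ℕ) (y : B) (hy : u ^ m * y = 0) : y = 0 := by
      induction m with
      | zero => simpa using hy
      | succ m ih => exact ih (hu _ (by rw [← hy]; ring))
    have hDg : u ^ e * biEval K t u (Polynomial.derivative g) = 0 := by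
      rw [mul_comm, ← hDt, ← apply_biEval hDu, ← hg]
      simp [D.leibniz, D.leibniz_pow, hDu, hx]
    have hder : Polynomial.derivative g = 0 :=
      biEval_injective hpt ((hpow _ _ hDg).trans (map_zero _).symm)
    have hconst := Polynomial.eq_C_of_natDegree_eq_zero
      (Polynomial.derivative_eq_zero.1 hder)
    rw [hconst, biEval_C] at hg
    exact mem_adjoin_of_pow_mul_eq_aeval hu hpt₀ n _ hg
  · intro hx
    obtain ⟨p, rfl⟩ := Algebra.adjoin_singleton_eq_range_aeval K u ▸ hx
    exact apply_aeval_eq_zero hDu p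

end LocallyNilpotent

theorem MvPolynomial.dvd_of_dvd_X_mul {σ R : Type*} [CommRing R] [IsDomain R] {i : σ}
    {F f : MvPolynomial σ R} (hF : ¬ X i ∣ F) (h : F ∣ X i * f) : F ∣ f := by
  obtain ⟨g, hg⟩ := h
  obtain ⟨k, rfl⟩ := (X_prime.dvd_or_dvd (Dvd.intro f hg)).resolve_left hF
  refine ⟨k, mul_left_cancel₀ (X_ne_zero i) ?_⟩
  rw [hg]
  ring

/-- Let `P ∈ ℂ[t]` be monic nonconstant and `e ≥ 1`, and let
`B = ℂ[t,u₊,u₋]/(u₊u₋ - P(t))`.  The `ℂ`-derivation of `ℂ[t,u₊,u₋]` with `δ u₊ = 0`,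
`δ t = u₊^e`, `δ u₋ = P'(t)·u₊^{e-1}` kills `u₊u₋ - P(t)`, hence descends to a `ℂ`-derivation
`∂₊` of `B`; this derivation is locally nilpotent and its kernel is `ℂ[u₊]`.  Here `t = X 0`,
`u₊ = X 1`, `u₋ = X 2` in `MvPolynomial (Fin 3) ℂ`. -/
theorem lnd_on_danielewski_surface_kernel
    (P : Polynomial ℂ) (hP : P.Monic) (hPdeg : 1 ≤ P.natDegree) (e : ℕ) (he : 1 ≤ e) :
    let δ : Derivation ℂ (MvPolynomial (Fin 3) ℂ) (MvPolynomial (Fin 3) ℂ) :=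
      MvPolynomial.mkDerivation ℂ
        ![X 1 ^ e, 0, Polynomial.aeval (X 0 : MvPolynomial (Fin 3) ℂ) P.derivative
            * X 1 ^ (e - 1)]
    let F : MvPolynomial (Fin 3) ℂ :=
      X 1 * X 2 - Polynomial.aeval (X 0 : MvPolynomial (Fin 3) ℂ) P
    δ F = 0 ∧
    ∃ D : Derivation ℂ (MvPolynomial (Fin 3) ℂ ⧸ Ideal.span {F})
        (MvPolynomial (Fin 3) ℂ ⧸ Ideal.span {F}),
      (∀ f : MvPolynomial (Fin 3) ℂ,
        D (Ideal.Quotient.mk (Ideal.span {F}) f) = Ideal.Quotient.mk (Ideal.span {F}) (δ f)) ∧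
      (∀ g, ∃ n : ℕ, (⇑D)^[n] g = 0) ∧
      {x : MvPolynomial (Fin 3) ℂ ⧸ Ideal.span {F} | D x = 0} =
        (Algebra.adjoin ℂ {Ideal.Quotient.mk (Ideal.span {F}) (X 1)} :
          Subalgebra ℂ (MvPolynomial (Fin 3) ℂ ⧸ Ideal.span {F})) := by
  intro δ F
  have hδ0 : δ (X 0) = X 1 ^ e := by simp [δ, mkDerivation_X]
  have hδ1 : δ (X 1) = 0 := by simp [δ, mkDerivation_X]
  have hδ2 : δ (X 2) = Polynomial.aeval (X 0 : MvPolynomial (Fin 3) ℂ) P.derivative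
      * X 1 ^ (e - 1) := by simp [δ, mkDerivation_X]
  have hδF : δ F = 0 := by
    obtain ⟨k, rfl⟩ := Nat.exists_eq_add_of_le' he
    simp only [F, map_sub, δ.leibniz, δ.map_aeval, hδ0, hδ1, hδ2, smul_eq_mul]
    simp only [Nat.add_sub_cancel]
    ring
  refine ⟨hδF, ?_⟩
  set I := Ideal.span {F} with hI
  have hmem (f) : (Ideal.Quotient.mkₐ ℂ I) f = 0 ↔ F ∣ f := by
    rw [Ideal.Quotient.mkₐ_eq_mk, Ideal.Quotient.eq_zero_iff_mem, hI, Ideal.mem_span_singleton]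
  let π := Ideal.Quotient.mkₐ ℂ I
  have hπ : Function.Surjective π := Ideal.Quotient.mkₐ_surjective ℂ I
  have hlift (f) (hf : π f = 0) : π (δ f) = 0 := by
    obtain ⟨g, rfl⟩ := (hmem f).1 hf
    refine (hmem _).2 ⟨δ g, ?_⟩
    rw [δ.leibniz, hδF, smul_zero, add_zero, smul_eq_mul]
  let D := Derivation.liftOfSurjective hπ hlift
  have hD (f) : D (π f) = π (δ f) := Derivation.liftOfSurjective_apply hπ hlift f
  have hgen : Algebra.adjoin ℂ {π (X 0), π (X 1), π (X 2)} = ⊤ := by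
    have hrange : ({π (X 0), π (X 1), π (X 2)} : Set (MvPolynomial (Fin 3) ℂ ⧸ I)) =
        π '' Set.range X := by
      ext y
      simp [Fin.exists_fin_succ, eq_comm]
    rw [hrange, ← AlgHom.map_adjoin, adjoin_range_X, Algebra.map_top,
      AlgHom.range_eq_top]
    exact hπ
  have huv : π (X 1) * π (X 2) = Polynomial.aeval (π (X 0)) P := by
    rw [Polynomial.aeval_algHom_apply, ← sub_eq_zero, ← map_mul, ← map_sub]
    exact (hmem _).2 dvd_rfl
  have hF (a b c : ℂ) : aeval ![a, b, c] F = b * c - P.eval a := by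
    rw [map_sub, map_mul, ← Polynomial.aeval_algHom_apply]
    simp [Polynomial.coe_aeval_eq_eval]
  have hpoint (a b c : ℂ) (h : b * c = P.eval a) :
      ∃ φ : (MvPolynomial (Fin 3) ℂ ⧸ I) →ₐ[ℂ] ℂ, φ (π (X 0)) = a ∧ φ (π (X 1)) = b := by
    refine ⟨Ideal.Quotient.liftₐ I (aeval ![a, b, c]) fun f hf => ?_, ?_, ?_⟩
    · obtain ⟨g, rfl⟩ := Ideal.mem_span_singleton.1 hf
      rw [map_mul, hF, h, sub_self, zero_mul]
    · simp [π]
    · simp [π]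
  have hX : ¬ X 1 ∣ F := by
    rintro ⟨g, hg⟩
    refine hP.ne_zero (Polynomial.funext fun a => ?_)
    have := congrArg (aeval ![a, 0, 0]) hg
    rw [hF] at this
    simpa using this
  have hu (x) (hx : π (X 1) * x = 0) : x = 0 := by
    obtain ⟨f, rfl⟩ := hπ x
    rw [← map_mul] at hx
    exact (hmem f).2 (dvd_of_dvd_X_mul hX ((hmem _).1 hx))
  have hDu : D (π (X 1)) = 0 := by rw [hD, hδ1, map_zero]
  have hDt : D (π (X 0)) = π (X 1) ^ e := by rw [hD, hδ0, map_pow]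
  refine ⟨D, hD, Derivation.exists_iterate_eq_zero_of_generators hgen huv hu hDu hDt,
    Set.ext fun x => Derivation.apply_eq_zero_iff_mem_adjoin hgen huv hu hDu hDt ?_ ?_ x⟩
  · intro a b hb
    exact hpoint a b (P.eval a / b) (mul_div_cancel₀ _ hb)
  · obtain ⟨a, ha⟩ := Complex.exists_root (Polynomial.natDegree_pos_iff_degree_pos.1 hPdeg)
    obtain ⟨φ, -, hφ⟩ := hpoint a 0 0 (by rw [zero_mul, ha.eq_zero])
    exact ⟨φ, hφ⟩
end
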